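/- arXiv:1407.0157 — 6 statements merged into one kernel-verified Lean document; each statement's English description precedes it below -/
import Mathlib

section
/- Let R be a commutative ring and n ≥ 1. For every natural number i with i ≠ n, the Ext group Ext^i_A(A/I, A), computed in the category of A-modules, vanishes (is trivial). -/
open CategoryTheory Opposite MvPolynomial

/-- Vanishing of the derived-category `Ext` implies vanishing of the left-derived `Ext`. -/
lemma subsingleton_oldExt_of_subsingleton_ext {A : Type} [CommRing A] (M N : ModuleCat.{0} A)
    (i : ℕ) (h : Subsingleton (Abelian.Ext.{0} M N i)) :
    Subsingleton ↥(((Ext A (ModuleCat.{0} A) i).obj (op M)).obj N) := by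
  let P : ProjectiveResolution M := projectiveResolution M
  have key : Limits.IsZero ((P.complex.linearYonedaObj A N).homology i) := by
    rw [← HomologicalComplex.exactAt_iff_isZero_homology]
    cases i with
    | zero =>
      rw [HomologicalComplex.exactAt_iff' _ 0 0 1 (by simp) (by simp),
        ShortComplex.moduleCat_exact_iff]
      intro (f : P.complex.X 0 ⟶ N) hf
      replace hf : P.complex.d 1 0 ≫ f = 0 := hf
      have hs : Subsingleton (M ⟶ N) := Abelian.Ext.addEquiv₀.subsingleton_congr.mp h
      have hf0 : f = 0 := by
        have h1 := P.exact₀.g_desc f hf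
        have h2 : P.exact₀.desc f hf = 0 := @Subsingleton.elim (M ⟶ N) hs _ _
        rw [← h1, h2, Limits.comp_zero]
      exact ⟨0, by rw [hf0]; exact map_zero _⟩
    | succ i =>
      rw [HomologicalComplex.exactAt_iff' _ i (i + 1) (i + 2) (by simp) (by simp),
        ShortComplex.moduleCat_exact_iff]
      intro (f : P.complex.X (i + 1) ⟶ N) hf
      replace hf : P.complex.d (i + 2) (i + 1) ≫ f = 0 := hf
      exact (P.extMk_eq_zero_iff f (i + 2) rfl hf i rfl).mp (Subsingleton.elim _ _)
  exact ModuleCat.subsingleton_of_isZero (key.of_iso (P.isoExt i N))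

/-- `Ext` vanishes below the length of a weakly regular sequence annihilating the source. -/
lemma subsingleton_ext_of_isWeaklyRegular {A : Type} [CommRing A] (N : ModuleCat.{0} A)
    (rs : List A) (mem : ∀ r ∈ rs, r ∈ Module.annihilator A N) :
    ∀ (M : ModuleCat.{0} A), RingTheory.Sequence.IsWeaklyRegular M rs →
      ∀ i < rs.length, Subsingleton (Abelian.Ext.{0} N M i) := by
  induction rs with
  | nil => simp
  | cons a rs ih =>
    intro M reg i hi
    simp only [RingTheory.Sequence.isWeaklyRegular_cons_iff] at reg
    simp only [List.mem_cons, forall_eq_or_imp] at mem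
    simp only [List.length_cons] at hi
    let g := (AddCommGrpCat.ofHom ((Abelian.Ext.mk₀ (ModuleCat.smulShortComplex M a).f).postcomp N
          (add_zero i)))
    have mono_g : Mono g := by
      cases i with
      | zero =>
        have := reg.1.smulShortComplex_shortExact.mono_f
        exact Abelian.Ext.mono_postcomp_mk₀_of_mono N _
      | succ i =>
        apply (Abelian.Ext.covariant_sequence_exact₁' N reg.1.smulShortComplex_shortExact i (i + 1)
            rfl).mono_g ((AddCommGrpCat.isZero_of_iff_subsingleton.mpr ?_).eq_zero_of_src _)
        exact ih mem.2 (ModuleCat.of A (QuotSMulTop a M)) reg.2 i (by omega)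
    have zero_g : g = 0 := Abelian.Ext.postcomp_smul_id_eq_zero_of_mem_annihilator mem.1 i
    exact AddCommGrpCat.subsingleton_of_isZero (Limits.IsZero.of_mono_eq_zero _ zero_g)

/-- The quotient by a weakly regular sequence raises projective dimension at most by its length. -/
lemma hasProjectiveDimensionLT_quotient {A : Type} [CommRing A] (rs : List A) :
    ∀ (M : ModuleCat.{0} A) (k : ℕ), HasProjectiveDimensionLT M k →
      RingTheory.Sequence.IsWeaklyRegular M rs →
      HasProjectiveDimensionLT
        (ModuleCat.of A (M ⧸ Ideal.ofList rs • (⊤ : Submodule A M))) (k + rs.length) := by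
  induction rs with
  | nil =>
    intro M k hk _
    have e : M ≅ ModuleCat.of A (M ⧸ Ideal.ofList ([] : List A) • (⊤ : Submodule A M)) :=
      (Submodule.quotEquivOfEqBot _ (by simp)).symm.toModuleIso
    exact hasProjectiveDimensionLT_of_iso e k
  | cons a rs ih =>
    intro M k hk reg
    simp only [RingTheory.Sequence.isWeaklyRegular_cons_iff] at reg
    have h1 : HasProjectiveDimensionLT (ModuleCat.of A (QuotSMulTop a M)) (k + 1) :=
      reg.1.smulShortComplex_shortExact.hasProjectiveDimensionLT_X₃ k hk
        (hasProjectiveDimensionLT_of_ge M k (k + 1) (Nat.le_succ k))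
    have h2 := ih _ _ h1 reg.2
    have h3 := hasProjectiveDimensionLT_of_iso
      (Submodule.quotOfListConsSMulTopEquivQuotSMulTopInner M a rs).symm.toModuleIso (k + 1 + rs.length)
    rw [List.length_cons, show k + (rs.length + 1) = k + 1 + rs.length by omega]
    exact h3

/-- The variables form a weakly regular sequence. -/
lemma isWeaklyRegular_variables (R : Type) [CommRing R] (n : ℕ) :
    RingTheory.Sequence.IsWeaklyRegular (MvPolynomial (Fin n) R)
      (List.ofFn (X : Fin n → MvPolynomial (Fin n) R)) := by
  constructor
  intro k hk
  have hkn : k < n := by simpa using hk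
  have hI : Ideal.ofList ((List.ofFn (X : Fin n → MvPolynomial (Fin n) R)).take k) =
      Ideal.span (X '' {j : Fin n | (j : ℕ) < k}) := by
    unfold Ideal.ofList
    congr 1
    ext p
    simp only [List.mem_take_iff_getElem, Set.mem_ofPred_eq, Set.mem_image, List.getElem_ofFn]
    constructor
    · rintro ⟨j, hj, rfl⟩
      exact ⟨⟨j, by simp at hj; omega⟩, by simp at hj ⊢; omega, rfl⟩
    · rintro ⟨j, hj, rfl⟩
      exact ⟨j, by simp; omega, rfl⟩
  rw [isSMulRegular_iff_right_eq_zero_of_smul]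
  intro q hq
  obtain ⟨p, rfl⟩ := Submodule.Quotient.mk_surjective _ q
  rw [← Submodule.Quotient.mk_smul, Submodule.Quotient.mk_eq_zero] at hq
  rw [Submodule.Quotient.mk_eq_zero]
  rw [smul_eq_mul, Ideal.mul_top, hI, mem_ideal_span_X_image] at hq ⊢
  intro m hm
  obtain ⟨j, hj, hmj⟩ := hq (Finsupp.single ⟨k, hkn⟩ 1 + m) (by
    rw [MvPolynomial.mem_support_iff] at hm ⊢
    simpa [MvPolynomial.coeff_X_mul] using hm)
  refine ⟨j, hj, ?_⟩
  have : (⟨k, hkn⟩ : Fin n) ≠ j := by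
    rintro rfl
    simp at hj
  simpa [Finsupp.single_apply, this] using hmj

/-- Let `R` be a commutative ring, `n ≥ 1`, `A = R[ξ₁,…,ξₙ]` the polynomial
ring in `n` variables and `I = (ξ₁,…,ξₙ)` the ideal generated by the variables.  For every
`i ≠ n`, the Ext group `Ext^i_A(A/I, A)`, computed in the category of `A`-modules, vanishes. -/
theorem ext_quotient_irrelevant_ideal_vanishes (R : Type) [CommRing R] (n : ℕ) (hn : 1 ≤ n)
    (i : ℕ) (hi : i ≠ n) :
    Subsingleton
      ↥(((Ext (MvPolynomial (Fin n) R) (ModuleCat (MvPolynomial (Fin n) R)) i).obj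
          (op (ModuleCat.of (MvPolynomial (Fin n) R)
            (MvPolynomial (Fin n) R ⧸
              Ideal.span (Set.range (X : Fin n → MvPolynomial (Fin n) R)))))).obj
        (ModuleCat.of (MvPolynomial (Fin n) R) (MvPolynomial (Fin n) R))) := by
  apply subsingleton_oldExt_of_subsingleton_ext
  have reg := isWeaklyRegular_variables R n
  have hI : Ideal.ofList (List.ofFn (X : Fin n → MvPolynomial (Fin n) R)) =
      Ideal.span (Set.range X) := by
    unfold Ideal.ofList
    congr 1
    ext p
    simp [List.mem_ofFn]
  rcases lt_or_gt_of_ne hi with h | h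
  · refine subsingleton_ext_of_isWeaklyRegular _ (List.ofFn X) ?_ _ reg i (by simpa using h)
    intro r hr
    rw [List.mem_ofFn] at hr
    change r ∈ Module.annihilator _ (MvPolynomial (Fin n) R ⧸
      Ideal.span (Set.range (X : Fin n → MvPolynomial (Fin n) R)))
    rw [Ideal.annihilator_quotient]
    exact Ideal.subset_span hr
  · have hp : HasProjectiveDimensionLT (ModuleCat.of (MvPolynomial (Fin n) R)
        (MvPolynomial (Fin n) R)) 1 := by
      have : Projective (ModuleCat.of (MvPolynomial (Fin n) R) (MvPolynomial (Fin n) R)) :=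
        (IsProjective.iff_projective _).mp inferInstance
      infer_instance
    have h1 := hasProjectiveDimensionLT_quotient _ _ 1 hp reg
    have e : ModuleCat.of (MvPolynomial (Fin n) R) (MvPolynomial (Fin n) R ⧸
        Ideal.ofList (List.ofFn (X : Fin n → MvPolynomial (Fin n) R)) •
          (⊤ : Submodule (MvPolynomial (Fin n) R) (MvPolynomial (Fin n) R))) ≅
        ModuleCat.of (MvPolynomial (Fin n) R)
            (MvPolynomial (Fin n) R ⧸
              Ideal.span (Set.range (X : Fin n → MvPolynomial (Fin n) R))) :=
      (Submodule.quotEquivOfEq _ _ (by rw [smul_eq_mul, Ideal.mul_top, hI])).toModuleIso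
    have h2 := hasProjectiveDimensionLT_of_iso e
      (1 + (List.ofFn (X : Fin n → MvPolynomial (Fin n) R)).length)
    exact h2.subsingleton _ _ i (by simp; omega) _
end

section
/- Let R be a commutative ring and n ≥ 1. The top Ext group Ext^n_A(A/I, A), computed in the category of A-modules, is isomorphic to A/I as an A-module (hence, as an R-module, isomorphic to R, which is the n-th exterior power of the free R-module Rⁿ). -/
open CategoryTheory Opposite MvPolynomial

/-- Inductive step: if `0 → M → M → N → 0` is exact with first map multiplication by `x`, and
`M` has projective dimension at most `k` with `Ext^k(M, Y) ≃ M`, the same holds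
for `N` and `k + 1`. -/
lemma ext_step {A : Type} [CommRing A] (M N Y : ModuleCat.{0} A) (x : A)
    (g : M →ₗ[A] N) (hg : Function.Surjective g)
    (hker : LinearMap.ker g = LinearMap.range (LinearMap.lsmul A M x))
    (hx : IsSMulRegular M x) (k : ℕ)
    (hpd : HasProjectiveDimensionLT M (k + 1))
    (hE : Nonempty (Abelian.Ext M Y k ≃ₗ[A] M)) :
    HasProjectiveDimensionLT N (k + 1 + 1) ∧ Nonempty (Abelian.Ext N Y (k + 1) ≃ₗ[A] N) := by
  have hex : Function.Exact (LinearMap.lsmul A M x) g := LinearMap.exact_iff.2 hker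
  let S : ShortComplex (ModuleCat.{0} A) :=
    ShortComplex.mk (x • 𝟙 M) (ModuleCat.ofHom g) (by
      ext m
      exact hex.apply_apply_eq_zero m)
  have hS : S.ShortExact :=
    { exact := by
        rw [ShortComplex.moduleCat_exact_iff]
        intro m hm
        exact (hex m).1 hm
      mono_f := by
        rw [ModuleCat.mono_iff_injective]
        exact hx
      epi_g := by
        rw [ModuleCat.epi_iff_surjective]
        exact hg }
  refine ⟨hS.hasProjectiveDimensionLT_X₃ (k + 1) hpd
    (hasProjectiveDimensionLT_of_ge M (k + 1) _ (by lia)), ?_⟩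
  obtain ⟨e⟩ := hE
  let φ : Abelian.Ext M Y k →ₗ[A] Abelian.Ext N Y (k + 1) :=
    Abelian.Ext.precompOfLinear hS.extClass A Y (by lia)
  have hφ : ∀ y, φ y = hS.extClass.comp y (by lia) := fun y => rfl
  have hmul : ∀ y : Abelian.Ext M Y k, (Abelian.Ext.mk₀ S.f).comp y (zero_add k) = x • y := by
    intro y
    change (Abelian.Ext.mk₀ (x • 𝟙 M)).comp y (zero_add k) = x • y
    rw [Abelian.Ext.mk₀_smul, Abelian.Ext.smul_comp, Abelian.Ext.mk₀_id_comp]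
  have hsurj : Function.Surjective φ := by
    intro z
    obtain ⟨y, hy⟩ := Abelian.Ext.contravariant_sequence_exact₃ hS Y z
      (Abelian.Ext.eq_zero_of_hasProjectiveDimensionLT (X := M) _ (k + 1) le_rfl)
      (n₀ := k) (by lia)
    exact ⟨y, hy⟩
  have hkφ : ∀ y, φ y = 0 ↔ ∃ y', x • y' = y := by
    intro y
    constructor
    · intro h
      obtain ⟨y', hy'⟩ := Abelian.Ext.contravariant_sequence_exact₁ hS Y y (by lia) h
      exact ⟨y', by rw [← hmul]; exact hy'⟩
    · rintro ⟨y', rfl⟩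
      rw [hφ, ← hmul]
      exact hS.extClass_comp_assoc _
  let ψ : M →ₗ[A] Abelian.Ext N Y (k + 1) := φ ∘ₗ e.symm.toLinearMap
  have hψ : Function.Surjective ψ := hsurj.comp e.symm.surjective
  have hkψ : LinearMap.ker ψ = LinearMap.ker g := by
    rw [hker]
    ext m
    simp only [LinearMap.mem_ker, LinearMap.mem_range]
    change φ (e.symm m) = 0 ↔ _
    rw [hkφ]
    constructor
    · rintro ⟨y', h⟩
      refine ⟨e y', ?_⟩
      simpa using congrArg e h
    · rintro ⟨m', rfl⟩
      exact ⟨e.symm m', by simp⟩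
  exact ⟨(ψ.quotKerEquivOfSurjective hψ).symm ≪≫ₗ Submodule.quotEquivOfEq _ _ hkψ ≪≫ₗ
    g.quotKerEquivOfSurjective hg⟩

/-- `Ext^{|s|}(A/(X_i, i ∈ s), A) ≃ A/(X_i, i ∈ s)`. -/
lemma ext_finset (R : Type) [CommRing R] {σ : Type} [DecidableEq σ] (s : Finset σ) :
    HasProjectiveDimensionLT (ModuleCat.of (MvPolynomial σ R)
      (MvPolynomial σ R ⧸ Ideal.span ((X : σ → MvPolynomial σ R) '' s))) (s.card + 1) ∧
    Nonempty (Abelian.Ext (ModuleCat.of (MvPolynomial σ R)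
      (MvPolynomial σ R ⧸ Ideal.span ((X : σ → MvPolynomial σ R) '' s)))
      (ModuleCat.of (MvPolynomial σ R) (MvPolynomial σ R)) s.card ≃ₗ[MvPolynomial σ R]
      (MvPolynomial σ R ⧸ Ideal.span ((X : σ → MvPolynomial σ R) '' s))) := by
  induction s using Finset.induction_on with
  | empty =>
    have h0 : Ideal.span ((X : σ → MvPolynomial σ R) '' (∅ : Finset σ)) = ⊥ := by simp
    rw [h0]
    let e : (MvPolynomial σ R ⧸ (⊥ : Ideal (MvPolynomial σ R))) ≃ₗ[MvPolynomial σ R]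
      MvPolynomial σ R := Submodule.quotEquivOfEqBot _ rfl
    have hp : Module.Projective (MvPolynomial σ R)
        (MvPolynomial σ R ⧸ (⊥ : Ideal (MvPolynomial σ R))) :=
      Module.Projective.of_equiv e.symm
    have : Projective (ModuleCat.of (MvPolynomial σ R)
        (MvPolynomial σ R ⧸ (⊥ : Ideal (MvPolynomial σ R)))) :=
      (IsProjective.iff_projective _).1 hp
    refine ⟨inferInstanceAs (HasProjectiveDimensionLT _ 1), ⟨?_⟩⟩
    exact (Abelian.Ext.linearEquiv₀ (R := MvPolynomial σ R)) ≪≫ₗ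
      ModuleCat.homLinearEquiv (S := MvPolynomial σ R) ≪≫ₗ
      LinearEquiv.congrLeft _ (MvPolynomial σ R) e ≪≫ₗ
      LinearMap.ringLmapEquivSelf _ (MvPolynomial σ R) _ ≪≫ₗ e.symm
  | insert i s hi ih =>
    obtain ⟨h1, h2⟩ := ih
    rw [Finset.card_insert_of_notMem hi]
    have hle : Ideal.span ((X : σ → MvPolynomial σ R) '' s) ≤
        Ideal.span ((X : σ → MvPolynomial σ R) '' (insert i s : Finset σ)) :=
      Ideal.span_mono (Set.image_mono (by simp))
    refine ext_step (ModuleCat.of (MvPolynomial σ R) (MvPolynomial σ R ⧸ Ideal.span _))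
      (ModuleCat.of (MvPolynomial σ R) (MvPolynomial σ R ⧸ Ideal.span _)) _ (X i)
      (Submodule.factor hle) (Submodule.factor_surjective hle) ?_ ?_ s.card h1 h2
    · ext m
      obtain ⟨p, rfl⟩ := Submodule.mkQ_surjective _ m
      simp only [LinearMap.mem_ker, LinearMap.mem_range]
      change Submodule.Quotient.mk p = 0 ↔ _
      rw [Submodule.Quotient.mk_eq_zero, Finset.coe_insert, Set.image_insert_eq,
        Ideal.mem_span_insert]
      constructor
      · rintro ⟨a, z, hz, rfl⟩
        refine ⟨Submodule.Quotient.mk a, ?_⟩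
        change Submodule.Quotient.mk ((X i : MvPolynomial σ R) • a) = Submodule.Quotient.mk _
        rw [Submodule.Quotient.eq]
        have : (X i : MvPolynomial σ R) • a - (a * X i + z) = -z := by rw [smul_eq_mul]; ring
        rw [this]
        exact neg_mem hz
      · rintro ⟨y, hy⟩
        obtain ⟨a, rfl⟩ := Submodule.mkQ_surjective _ y
        change Submodule.Quotient.mk ((X i : MvPolynomial σ R) • a) = Submodule.Quotient.mk _ at hy
        rw [Submodule.Quotient.eq] at hy
        refine ⟨a, -((X i : MvPolynomial σ R) • a - p), neg_mem hy, ?_⟩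
        rw [smul_eq_mul]; ring
    · refine (isSMulRegular_quotient_iff_mem_of_smul_mem _ _).2 ?_
      intro p hp
      rw [smul_eq_mul, mem_ideal_span_X_image] at hp
      rw [mem_ideal_span_X_image]
      intro m hm
      obtain ⟨j, hj, hne⟩ := hp (Finsupp.single i 1 + m) (by
        rw [mem_support_iff, coeff_X_mul]
        exact mem_support_iff.1 hm)
      refine ⟨j, hj, ?_⟩
      have hij : i ≠ j := by rintro rfl; exact hi hj
      simpa [Finsupp.single_apply, hij] using hne

/-- The two versions of `Ext` agree in positive degrees. -/
lemma ext_compare {A : Type} [CommRing A] (M Y : ModuleCat.{0} A) (k : ℕ) :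
    Nonempty ((((Ext A (ModuleCat.{0} A) (k + 1)).obj (op M)).obj Y) ≅
      ModuleCat.of A (Abelian.Ext M Y (k + 1))) := by
  let P : ProjectiveResolution M := projectiveResolution M
  let S : ShortComplex (ModuleCat.{0} A) :=
    (P.complex.linearYonedaObj A Y).sc' k (k + 1) (k + 2)
  have hgS : ∀ f : P.complex.X (k + 1) ⟶ Y, S.g.hom f = P.complex.d (k + 2) (k + 1) ≫ f :=
    fun f => rfl
  have hfS : ∀ f : P.complex.X k ⟶ Y, S.f.hom f = P.complex.d (k + 1) k ≫ f :=
    fun f => rfl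
  have hsmul : ∀ (r : A) (f : P.complex.X (k + 1) ⟶ Y)
      (hf : P.complex.d (k + 2) (k + 1) ≫ f = 0),
      P.extMk (n := k + 1) (r • f) (k + 2) rfl (by simp [hf]) =
        r • P.extMk (n := k + 1) f (k + 2) rfl hf := by
    intro r f hf
    rw [Abelian.Ext.smul_eq_comp_mk₀, P.extMk_comp_mk₀]
    congr 1
  let θ : LinearMap.ker S.g.hom →ₗ[A] Abelian.Ext M Y (k + 1) :=
    { toFun := fun f => P.extMk (n := k + 1) f.1 (k + 2) rfl f.2
      map_add' := fun f g => (P.add_extMk _ _ _ _ _ _).symm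
      map_smul' := fun r f => by
        exact hsmul r f.1 f.2 }
  have hθ : Function.Surjective θ := by
    intro z
    obtain ⟨f, hf, rfl⟩ := P.extMk_surjective z (k + 2) rfl
    exact ⟨⟨f, hf⟩, rfl⟩
  have hk : LinearMap.range S.moduleCatToCycles = LinearMap.ker θ := by
    ext f
    rw [LinearMap.mem_ker]
    change _ ↔ P.extMk (n := k + 1) f.1 (k + 2) rfl f.2 = 0
    refine Iff.trans ?_ (P.extMk_eq_zero_iff (n := k + 1) f.1 (k + 2) rfl f.2 k rfl).symm
    rw [LinearMap.mem_range]
    constructor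
    · rintro ⟨g, rfl⟩
      exact ⟨g, rfl⟩
    · rintro ⟨g, hg⟩
      exact ⟨g, Subtype.ext hg⟩
  exact ⟨P.isoExt (k + 1) Y ≪≫
    ((P.complex.linearYonedaObj A Y).homologyIsoSc' k (k + 1) (k + 2) (by simp) (by simp)) ≪≫
    S.moduleCatHomologyIso ≪≫
    (Submodule.quotEquivOfEq _ _ hk ≪≫ₗ θ.quotKerEquivOfSurjective hθ).toModuleIso⟩

/-- Let `R` be a commutative ring, `n ≥ 1`, `A = R[ξ₁,…,ξₙ]` and
`I = (ξ₁,…,ξₙ)`.  The top Ext group `Ext^n_A(A/I, A)`, computed in the category of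
`A`-modules, is isomorphic to `A/I` as an `A`-module. -/
theorem top_ext_quotient_irrelevant_ideal (R : Type) [CommRing R] (n : ℕ) (hn : 1 ≤ n) :
    Nonempty
      ((((Ext (MvPolynomial (Fin n) R) (ModuleCat (MvPolynomial (Fin n) R)) n).obj
          (op (ModuleCat.of (MvPolynomial (Fin n) R)
            (MvPolynomial (Fin n) R ⧸
              Ideal.span (Set.range (X : Fin n → MvPolynomial (Fin n) R)))))).obj
            (ModuleCat.of (MvPolynomial (Fin n) R) (MvPolynomial (Fin n) R))) ≅
        ModuleCat.of (MvPolynomial (Fin n) R)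
          (MvPolynomial (Fin n) R ⧸
            Ideal.span (Set.range (X : Fin n → MvPolynomial (Fin n) R)))) := by
  obtain ⟨k, rfl⟩ : ∃ k, n = k + 1 := ⟨n - 1, by lia⟩
  obtain ⟨-, ⟨e⟩⟩ := ext_finset R (Finset.univ : Finset (Fin (k + 1)))
  obtain ⟨c⟩ := ext_compare (ModuleCat.of (MvPolynomial (Fin (k + 1)) R)
    (MvPolynomial (Fin (k + 1)) R ⧸
      Ideal.span (Set.range (X : Fin (k + 1) → MvPolynomial (Fin (k + 1)) R))))
    (ModuleCat.of (MvPolynomial (Fin (k + 1)) R) (MvPolynomial (Fin (k + 1)) R)) k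
  rw [Finset.coe_univ, Set.image_univ, Finset.card_univ, Fintype.card_fin] at e
  exact ⟨c ≪≫ e.toModuleIso⟩
end

section
/- Let R be a commutative Noetherian ring and n ≥ 1. For every natural number j with j ≠ n, the local cohomology module H^j_I(A) of A (as a module over itself) with support in the irrelevant ideal I vanishes. -/
open CategoryTheory MvPolynomial
open Limits

lemma aux_old_ext_zero {A : Type} [CommRing A] (N M : ModuleCat.{0} A) (j : ℕ)
    (h : Subsingleton (Abelian.Ext N M j)) :
    IsZero (((_root_.Ext A (ModuleCat.{0} A) j).obj (Opposite.op N)).obj M) := by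
  let P : ProjectiveResolution N := ProjectiveResolution.of N
  refine IsZero.of_iso ?_ (P.isoExt j M)
  rw [← HomologicalComplex.exactAt_iff_isZero_homology]
  cases j with
  | zero =>
    rw [HomologicalComplex.exactAt_iff' _ 0 0 1 (by simp) (by simp),
      ShortComplex.moduleCat_exact_iff]
    intro (f : P.complex.X 0 ⟶ M) hf
    have hf' : P.complex.d 1 0 ≫ f = 0 := hf
    have hs : Subsingleton (N ⟶ M) := Abelian.Ext.homEquiv₀.subsingleton_congr.mp h
    have h0 : P.exact₀.desc f hf' = 0 := @Subsingleton.elim (N ⟶ M) hs _ _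
    have h1 : f = 0 := by
      rw [← P.exact₀.g_desc f hf', h0, comp_zero]
    exact ⟨0, by rw [map_zero]; exact h1.symm⟩
  | succ p =>
    rw [HomologicalComplex.exactAt_iff' _ p (p+1) (p+2) (by simp) (by simp),
      ShortComplex.moduleCat_exact_iff]
    intro (f : P.complex.X (p+1) ⟶ M) hf
    have hf' : P.complex.d (p+2) (p+1) ≫ f = 0 := hf
    obtain ⟨g, hg⟩ := (P.extMk_eq_zero_iff f (p+2) rfl hf' p rfl).1 (Subsingleton.elim _ _)
    exact ⟨g, hg⟩

lemma aux_pd {A : Type} [CommRing A] (rs : List A) (M : ModuleCat.{0} A) (m : ℕ)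
    (hM : HasProjectiveDimensionLT M m) (reg : RingTheory.Sequence.IsWeaklyRegular M rs) :
    HasProjectiveDimensionLT
      (ModuleCat.of A (M ⧸ Ideal.ofList rs • (⊤ : Submodule A M))) (m + rs.length) := by
  induction rs generalizing M m with
  | nil =>
    have e : (M ⧸ Ideal.ofList ([] : List A) • (⊤ : Submodule A M)) ≃ₗ[A] M :=
      Submodule.quotEquivOfEqBot _ (by simp)
    exact hasProjectiveDimensionLT_of_iso (X := M) e.symm.toModuleIso _
  | cons x rs ih =>
    rw [RingTheory.Sequence.isWeaklyRegular_cons_iff] at reg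
    have h1 : HasProjectiveDimensionLT (ModuleCat.of A (QuotSMulTop x M)) (m + 1) :=
      (reg.1.smulShortComplex_shortExact).hasProjectiveDimensionLT_X₃ m hM
        (hasProjectiveDimensionLT_of_ge M m (m + 1) (Nat.le_add_right _ 1))
    have h2 := ih (ModuleCat.of A (QuotSMulTop x M)) (m+1) h1 reg.2
    have h3 := hasProjectiveDimensionLT_of_iso
        (Submodule.quotOfListConsSMulTopEquivQuotSMulTopInner M x rs).symm.toModuleIso (m + 1 + rs.length)
    rw [List.length_cons, ← add_assoc, add_right_comm]
    exact h3

lemma aux_isZero_obj {A : Type} [CommRing A] (F : ℕᵒᵖᵒᵖ ⥤ ModuleCat.{0} A ⥤ ModuleCat.{0} A)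
    (M : ModuleCat.{0} A)
    (h : ∀ k, ∃ (m : ℕᵒᵖᵒᵖ) (f : k ⟶ m), (F.map f).app M = 0) :
    IsZero ((colimit F).obj M) := by
  refine IsZero.of_iso ?_ (colimitObjIsoColimitCompEvaluation F M)
  rw [IsZero.iff_id_eq_zero]
  apply colimit.hom_ext
  intro k
  obtain ⟨m, f, hf⟩ := h k
  rw [comp_zero, Category.comp_id, ← colimit.w _ f]
  have : (F ⋙ (evaluation (ModuleCat A) (ModuleCat A)).obj M).map f = 0 := hf
  rw [this, zero_comp]

section
variable (R : Type) [CommRing R] (n k : ℕ)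

/-- powers of the variables -/
noncomputable def auxSeq : List (MvPolynomial (Fin n) R) := List.ofFn fun i => X i ^ k

lemma aux_length : (auxSeq R n k).length = n := by simp [auxSeq]

lemma aux_mem_ofList (i : ℕ) (f : MvPolynomial (Fin n) R) :
    f ∈ Ideal.ofList ((auxSeq R n k).take i) ↔
      ∀ s ∈ f.support, ∃ j : Fin n, (j : ℕ) < i ∧ k ≤ s j := by
  have : {x | x ∈ (auxSeq R n k).take i} =
      Set.image (fun s => monomial s (1 : R))
        (Set.image (fun j : Fin n => Finsupp.single j k) {j | (j : ℕ) < i}) := by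
    ext x
    simp only [auxSeq, List.mem_take_iff_getElem, Set.mem_ofPred_eq, Set.mem_image,
      exists_exists_and_eq_and]
    constructor
    · rintro ⟨j, hj, rfl⟩
      have hj' : j < i ∧ j < n := by simpa using hj
      exact ⟨⟨j, hj'.2⟩, hj'.1, by simp [X_pow_eq_monomial]⟩
    · rintro ⟨j, hj, rfl⟩
      exact ⟨j, by simp [hj], by simp [X_pow_eq_monomial]⟩
  rw [Ideal.ofList, this, mem_ideal_span_monomial_image]
  simp

lemma aux_weaklyRegular :
    RingTheory.Sequence.IsWeaklyRegular (MvPolynomial (Fin n) R) (auxSeq R n k) := by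
  constructor
  intro i hi
  have hin : i < n := by simpa [auxSeq] using hi
  have hx : (auxSeq R n k)[i] = monomial (Finsupp.single ⟨i, hin⟩ k) 1 := by
    simp [auxSeq, X_pow_eq_monomial]
  rw [hx, isSMulRegular_iff_right_eq_zero_of_smul]
  intro q
  obtain ⟨f, rfl⟩ := Submodule.mkQ_surjective _ q
  intro hf
  rw [← map_smul, Submodule.mkQ_apply, Submodule.Quotient.mk_eq_zero, smul_eq_mul, smul_eq_mul,
    Ideal.mul_top, aux_mem_ofList] at hf
  rw [Submodule.mkQ_apply, Submodule.Quotient.mk_eq_zero, smul_eq_mul,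
    Ideal.mul_top, aux_mem_ofList]
  intro s hs
  obtain ⟨j, hj, hk⟩ := hf (Finsupp.single ⟨i, hin⟩ k + s) (by
    rw [mem_support_iff, coeff_monomial_mul, one_mul]; exact mem_support_iff.1 hs)
  refine ⟨j, hj, ?_⟩
  have hne : j ≠ ⟨i, hin⟩ := by rintro rfl; simp at hj
  simpa [Finsupp.single_apply, hne.symm] using hk

end

lemma aux_ext_zero (R : Type) [CommRing R] [IsNoetherianRing R] [Nontrivial R] (n k j : ℕ)
    (hk : 1 ≤ k) (hj : j ≠ n) :
    IsZero (((_root_.Ext (MvPolynomial (Fin n) R) (ModuleCat.{0} (MvPolynomial (Fin n) R)) j).obj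
      (Opposite.op (ModuleCat.of _
        (MvPolynomial (Fin n) R ⧸ Ideal.ofList (auxSeq R n k))))).obj
        (ModuleCat.of _ (MvPolynomial (Fin n) R))) := by
  apply aux_old_ext_zero
  rcases lt_or_gt_of_ne hj with hj | hj
  · have hne : Ideal.ofList (auxSeq R n k) ≠ ⊤ := by
      intro h
      have h1 : (1 : MvPolynomial (Fin n) R) ∈ Ideal.ofList ((auxSeq R n k).take n) := by
        rw [List.take_of_length_le (aux_length R n k).le, h]; trivial
      rw [aux_mem_ofList] at h1
      obtain ⟨i, -, hi⟩ := h1 0 (by simp)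
      simp at hi
      omega
    refine ModuleCat.subsingleton_ext_of_exists_isRegular (Ideal.ofList (auxSeq R n k)) _ ?_ _ ?_
      (auxSeq R n k) (fun r hr => Ideal.subset_span hr) ⟨aux_weaklyRegular R n k, ?_⟩ j
      (by rwa [aux_length])
    · rw [Module.support_eq_zeroLocus]
      erw [Ideal.annihilator_quotient]
    · rw [smul_eq_mul, Ideal.mul_top]
      exact lt_top_iff_ne_top.2 hne
    · rw [smul_eq_mul, Ideal.mul_top]
      exact hne.symm
  · have h1 : Projective (ModuleCat.of (MvPolynomial (Fin n) R) (MvPolynomial (Fin n) R)) :=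
      inferInstance
    have h2 := aux_pd (auxSeq R n k) (ModuleCat.of _ (MvPolynomial (Fin n) R)) 1 inferInstance
      (aux_weaklyRegular R n k)
    have e : (MvPolynomial (Fin n) R ⧸ Ideal.ofList (auxSeq R n k) •
        (⊤ : Submodule (MvPolynomial (Fin n) R) (MvPolynomial (Fin n) R))) ≃ₗ[MvPolynomial (Fin n) R]
        (MvPolynomial (Fin n) R ⧸ Ideal.ofList (auxSeq R n k)) :=
      Submodule.quotEquivOfEq _ _ (by rw [smul_eq_mul, Ideal.mul_top])
    have h3 := hasProjectiveDimensionLT_of_iso e.toModuleIso (1 + (auxSeq R n k).length)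
    exact HasProjectiveDimensionLT.subsingleton _ (1 + (auxSeq R n k).length) j
      (by rw [aux_length]; omega) _

/-- Let `R` be a commutative Noetherian ring, `n ≥ 1`, `A = R[ξ₁,…,ξₙ]` and
`I = (ξ₁,…,ξₙ)` the irrelevant ideal.  For every `j ≠ n`, the local cohomology module
`H^j_I(A)` of `A` (as a module over itself) vanishes. -/
theorem localCohomology_polynomial_irrelevant_vanishes (R : Type) [CommRing R]
    [IsNoetherianRing R] (n : ℕ) (hn : 1 ≤ n) (j : ℕ) (hj : j ≠ n) :
    Subsingleton
      ↥((localCohomology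
          (Ideal.span (Set.range (X : Fin n → MvPolynomial (Fin n) R))) j).obj
        (ModuleCat.of (MvPolynomial (Fin n) R) (MvPolynomial (Fin n) R))) := by
  rcases subsingleton_or_nontrivial R with hR | hR
  · exact Module.subsingleton (MvPolynomial (Fin n) R) _
  set I : Ideal (MvPolynomial (Fin n) R) :=
    Ideal.span (Set.range (X : Fin n → MvPolynomial (Fin n) R)) with hI
  apply ModuleCat.subsingleton_of_isZero
  refine aux_isZero_obj (localCohomology.diagram (localCohomology.idealPowersDiagram I) j) _ ?_
  intro k
  obtain ⟨k, rfl⟩ : ∃ k' : ℕ, k = Opposite.op (Opposite.op k') := ⟨k.unop.unop, rfl⟩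
  let J : Ideal (MvPolynomial (Fin n) R) := Ideal.ofList (auxSeq R n (k + 1))
  have hJI : J ≤ I ^ k := by
    refine Ideal.span_le.2 ?_
    intro x hx
    obtain ⟨i, rfl⟩ : ∃ i, X i ^ (k+1) = x := by simpa [auxSeq] using hx
    exact Ideal.pow_le_pow_right (Nat.le_succ k)
      (Ideal.pow_mem_pow (Ideal.subset_span (Set.mem_range_self i)) _)
  have hrad : I ≤ J.radical := by
    refine Ideal.span_le.2 ?_
    rintro _ ⟨i, rfl⟩
    exact ⟨k + 1, Ideal.subset_span (by simp [auxSeq])⟩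
  obtain ⟨m, hm⟩ := Ideal.exists_pow_le_of_le_radical_of_fg hrad (IsNoetherian.noetherian I)
  have hm' : I ^ (k + m) ≤ J := (Ideal.pow_le_pow_right (Nat.le_add_left m k)).trans hm
  refine ⟨Opposite.op (Opposite.op (k + m)), (homOfLE (Nat.le_add_right k m)).op.op, ?_⟩
  let a : ModuleCat.of (MvPolynomial (Fin n) R) (MvPolynomial (Fin n) R ⧸ I ^ (k + m)) ⟶
      ModuleCat.of _ (MvPolynomial (Fin n) R ⧸ J) :=
    ModuleCat.ofHom (Submodule.mapQ _ _ LinearMap.id hm')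
  let b : ModuleCat.of (MvPolynomial (Fin n) R) (MvPolynomial (Fin n) R ⧸ J) ⟶
      ModuleCat.of _ (MvPolynomial (Fin n) R ⧸ I ^ k) :=
    ModuleCat.ofHom (Submodule.mapQ _ _ LinearMap.id hJI)
  have hab : (localCohomology.ringModIdeals (localCohomology.idealPowersDiagram I)).map
      (homOfLE (Nat.le_add_right k m)).op = a ≫ b := by
    apply ModuleCat.hom_ext
    apply LinearMap.ext
    intro q
    obtain ⟨f, rfl⟩ := Submodule.mkQ_surjective _ q
    rfl
  have hz := aux_ext_zero R n (k + 1) j (Nat.le_add_left 1 k) hj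
  have key : ((_root_.Ext (MvPolynomial (Fin n) R)
      (ModuleCat.{0} (MvPolynomial (Fin n) R)) j).map (a ≫ b).op).app
        (ModuleCat.of _ (MvPolynomial (Fin n) R)) = 0 := by
    rw [op_comp, Functor.map_comp, NatTrans.comp_app, hz.eq_zero_of_tgt
      (((_root_.Ext (MvPolynomial (Fin n) R)
      (ModuleCat.{0} (MvPolynomial (Fin n) R)) j).map b.op).app _), zero_comp]
  rw [← hab] at key
  exact key
end

section
/- Let A be a commutative Noetherian ring, 𝔞 ⊆ A an ideal, and M an A-module. Let T_𝔞(M) := colim_k Hom_A(𝔞^k, M) be the ideal transform, where the transition maps are given by restriction of homomorphisms along the inclusions 𝔞^{k+1} ⊆ 𝔞^k. Then there is an exact sequence of A-modules 0 → H⁰_𝔞(M) → M → T_𝔞(M) → H¹_𝔞(M) → 0, in which the map M → T_𝔞(M) sends an element m to the compatible system of restrictions to 𝔞^k of the homomorphism a ↦ a·m. -/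
open CategoryTheory

namespace IdealTransformAux
open Limits Opposite

section cls
variable {A : Type} [CommRing A]

/-- The cocycles in degree `n`, as a submodule. -/
abbrev Z (K : CochainComplex (ModuleCat.{0} A) ℕ) (n : ℕ) : Submodule A (K.X n) :=
  LinearMap.ker (K.d n (n+1)).hom

/-- A cocycle as an element of the abstract cycles. -/
noncomputable def cyc (K : CochainComplex (ModuleCat.{0} A) ℕ) (n : ℕ) :
    Z K n →ₗ[A] K.cycles n :=
  (K.liftCycles (ModuleCat.ofHom (Z K n).subtype) (n+1) (by simp) (by ext x; exact x.2)).hom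

lemma i_cyc (K : CochainComplex (ModuleCat.{0} A) ℕ) (n : ℕ) (z : Z K n) :
    (K.iCycles n).hom (cyc K n z) = z.1 := by
  have : (K.liftCycles (ModuleCat.ofHom (Z K n).subtype) (n+1) (by simp) (by ext x; exact x.2)) ≫
    K.iCycles n = _ := K.liftCycles_i _ _ _ _
  exact congrArg (fun f => f.hom z) this

lemma i_inj (K : CochainComplex (ModuleCat.{0} A) ℕ) (n : ℕ) :
    Function.Injective (K.iCycles n).hom :=
  (ModuleCat.mono_iff_injective (K.iCycles n)).1 inferInstance

/-- The class of a cocycle. -/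
noncomputable def cls (K : CochainComplex (ModuleCat.{0} A) ℕ) (n : ℕ) :
    Z K n →ₗ[A] K.homology n := (K.homologyπ n).hom ∘ₗ cyc K n

lemma cls_nat {K L : CochainComplex (ModuleCat.{0} A) ℕ} (φ : K ⟶ L) (n : ℕ)
    (z : Z K n) (z' : Z L n) (h : z'.1 = (φ.f n).hom z.1) :
    (HomologicalComplex.homologyMap φ n).hom (cls K n z) = cls L n z' := by
  have h1 : ∀ x, (HomologicalComplex.homologyMap φ n).hom ((K.homologyπ n).hom x) =
      (L.homologyπ n).hom ((HomologicalComplex.cyclesMap φ n).hom x) := fun x => 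
    congrArg (fun f => f.hom x) (HomologicalComplex.homologyπ_naturality φ n)
  have h2 : ∀ x, (L.iCycles n).hom ((HomologicalComplex.cyclesMap φ n).hom x) =
      (φ.f n).hom ((K.iCycles n).hom x) := fun x => 
    congrArg (fun f => f.hom x) (HomologicalComplex.cyclesMap_i φ n)
  simp only [cls, LinearMap.comp_apply]
  rw [h1]
  congr 1
  apply i_inj
  rw [h2, i_cyc, i_cyc, h]

lemma cls_surj (K : CochainComplex (ModuleCat.{0} A) ℕ) (n : ℕ) :
    Function.Surjective (cls K n) := by
  intro y
  obtain ⟨c, rfl⟩ := (ModuleCat.epi_iff_surjective (K.homologyπ n)).1 inferInstance y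
  refine ⟨⟨(K.iCycles n).hom c, ?_⟩, ?_⟩
  · exact congrArg (fun f => f.hom c) (K.iCycles_d n (n+1))
  · simp only [cls, LinearMap.comp_apply]
    change _ = (K.homologyπ n).hom c
    congr 1
    apply i_inj
    rw [i_cyc]

lemma cls_zero_iff (K : CochainComplex (ModuleCat.{0} A) ℕ) (n : ℕ) (z : Z K (n+1)) :
    cls K (n+1) z = 0 ↔ ∃ w, (K.d n (n+1)).hom w = z.1 := by
  have ex : (ShortComplex.mk (K.toCycles n (n+1)) (K.homologyπ (n+1)) (by simp)).Exact :=
    ShortComplex.exact_of_g_is_cokernel _ (K.homologyIsCokernel n (n+1) (by simp))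
  rw [ShortComplex.moduleCat_exact_iff] at ex
  have h2 : ∀ x, (K.iCycles (n+1)).hom ((K.toCycles n (n+1)).hom x) = (K.d n (n+1)).hom x :=
    fun x => congrArg (fun f => f.hom x) (K.toCycles_i n (n+1))
  have h3 : ∀ x, (K.homologyπ (n+1)).hom ((K.toCycles n (n+1)).hom x) = 0 :=
    fun x => congrArg (fun f => f.hom x) (K.toCycles_comp_homologyπ n (n+1))
  simp only [cls, LinearMap.comp_apply]
  constructor
  · intro h
    obtain ⟨w, hw⟩ := ex _ h
    refine ⟨w, ?_⟩
    rw [← h2, ← i_cyc]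
    exact congrArg (K.iCycles (n+1)).hom hw
  · rintro ⟨w, hw⟩
    have : cyc K (n+1) z = (K.toCycles n (n+1)).hom w := by
      apply i_inj
      rw [h2, hw, i_cyc]
    rw [this, h3]

lemma cls_zero_inj (K : CochainComplex (ModuleCat.{0} A) ℕ) :
    Function.Injective (cls K 0) := by
  have : IsIso (K.homologyπ 0) := by
    apply K.isIso_homologyπ _ 0 rfl
    simp
  have h2 : Function.Injective (K.homologyπ 0).hom :=
    (ModuleCat.mono_iff_injective (K.homologyπ 0)).1 inferInstance 
  intro z z' h
  have := congrArg (K.iCycles 0).hom (h2 h)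
  rw [i_cyc, i_cyc] at this
  exact Subtype.ext this

end cls

section ext
variable {A : Type} [CommRing A]

/-- precomposition chain map. -/
noncomputable def yonMap {P Q : ChainComplex (ModuleCat.{0} A) ℕ} (g : P ⟶ Q) (M : ModuleCat.{0} A) :
    Q.linearYonedaObj A M ⟶ P.linearYonedaObj A M :=
  (HomologicalComplex.unopFunctor _ _).map
   ((((linearYoneda A (ModuleCat.{0} A)).obj M).rightOp.mapHomologicalComplex _).map g).op

lemma glue {C : Type*} [Category C] {HQ HP UQ UP EQ EP : C} (a : HQ ⟶ UQ) (b : UQ ⟶ EQ)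
    (e : EQ ⟶ EP) (a' : HP ⟶ UP) (b' : UP ⟶ EP) (u : UQ ⟶ UP) (m : HQ ⟶ HP)
    (h1 : b ≫ e = u ≫ b') (h2 : a ≫ u = m ≫ a') : (a ≫ b) ≫ e = m ≫ (a' ≫ b') := by
  rw [Category.assoc, h1, ← Category.assoc, h2, Category.assoc]

lemma isoExt_nat {X Y : ModuleCat.{0} A} (f : X ⟶ Y) (P : ProjectiveResolution X)
    (Q : ProjectiveResolution Y) (g : P.complex ⟶ Q.complex)
    (comm : g.f 0 ≫ Q.π.f 0 = P.π.f 0 ≫ f) (n : ℕ) (M : ModuleCat.{0} A) :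
    (Q.isoExt (R := A) n M).inv ≫ ((Ext A (ModuleCat.{0} A) n).map f.op).app M =
       HomologicalComplex.homologyMap (yonMap g M) n ≫ (P.isoExt (R := A) n M).inv := by
  have h := ProjectiveResolution.isoLeftDerivedObj_hom_naturality f P Q g comm
    ((linearYoneda A (ModuleCat.{0} A)).obj M).rightOp n
  have h' := congrArg Quiver.Hom.unop h
  have h2 := HomologicalComplex.homologyOp_hom_naturality (yonMap g M) n
  have h2' := congrArg Quiver.Hom.unop h2
  exact glue _ _ _ _ _ _ _ h' h2'

lemma yonMap_f {P Q : ChainComplex (ModuleCat.{0} A) ℕ} (g : P ⟶ Q) (M : ModuleCat.{0} A) (n : ℕ)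
   (z : Q.X n ⟶ M) : ((yonMap g M).f n).hom z = (g.f n ≫ z : P.X n ⟶ M) := rfl

lemma yon_d {Q : ChainComplex (ModuleCat.{0} A) ℕ} (M : ModuleCat.{0} A) (n m : ℕ)
   (z : Q.X n ⟶ M) : ((Q.linearYonedaObj A M).d n m).hom z = (Q.d m n ≫ z : Q.X m ⟶ M) := rfl
end ext

section alg
variable {A : Type} [CommRing A] {J : Ideal A} {M P0 P1 P2 : Type} [AddCommGroup M] [Module A M]
  [AddCommGroup P0] [Module A P0] [AddCommGroup P1] [Module A P1] [AddCommGroup P2] [Module A P2]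

/-- The map `P1 → J` induced by a lift `s : P0 → A`. -/
def sig (d1 : P1 →ₗ[A] P0) (π : P0 →ₗ[A] (A ⧸ J)) (h1 : Function.Exact d1 π)
    (s : P0 →ₗ[A] A) (hs : ∀ x, Submodule.Quotient.mk (s x) = π x) : P1 →ₗ[A] J :=
  (s ∘ₗ d1).codRestrict J fun p => by
    have := hs (d1 p)
    rw [h1.apply_apply_eq_zero] at this
    exact (Submodule.Quotient.mk_eq_zero J).1 this

lemma sig_cocycle (d2 : P2 →ₗ[A] P1) (d1 : P1 →ₗ[A] P0) (π : P0 →ₗ[A] (A ⧸ J))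
    (h2 : Function.Exact d2 d1) (h1 : Function.Exact d1 π) (s : P0 →ₗ[A] A) (hs : ∀ x, Submodule.Quotient.mk (s x) = π x)
    (p : P2) : sig d1 π h1 s hs (d2 p) = 0 := by
  apply Subtype.ext
  simp [sig, h2.apply_apply_eq_zero]

lemma alg_surj (d2 : P2 →ₗ[A] P1) (d1 : P1 →ₗ[A] P0) (π : P0 →ₗ[A] (A ⧸ J))
    (h2 : Function.Exact d2 d1) (h1 : Function.Exact d1 π) (s : P0 →ₗ[A] A) (hs : ∀ x, Submodule.Quotient.mk (s x) = π x) (e : P0) (he : π e = Submodule.Quotient.mk 1)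
    (φ : P1 →ₗ[A] M) (hφ : ∀ p, φ (d2 p) = 0) :
    ∃ (h : J →ₗ[A] M) (ψ : P0 →ₗ[A] M), ∀ p, ψ (d1 p) = h (sig d1 π h1 s hs p) - φ p := by
  obtain ⟨φ', hφ'⟩ : ∃ φ' : LinearMap.ker π →ₗ[A] M, ∀ p (hp : d1 p ∈ LinearMap.ker π),
      φ' ⟨d1 p, hp⟩ = φ p := by
    have hle : LinearMap.ker d1 ≤ LinearMap.ker φ := by
      intro p hp
      obtain ⟨q, rfl⟩ := (h2 p).1 hp
      exact hφ q
    refine ⟨(LinearMap.ker d1).liftQ φ hle ∘ₗ d1.quotKerEquivRange.symm.toLinearMap ∘ₗ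
      (LinearEquiv.ofEq _ _ h1.linearMap_ker_eq).toLinearMap, fun p hp => ?_⟩
    have : d1.quotKerEquivRange.symm ⟨d1 p, p, rfl⟩ = (LinearMap.ker d1).mkQ p :=
      d1.quotKerEquivRange_symm_apply_image p ⟨p, rfl⟩
    change (LinearMap.ker d1).liftQ φ hle (d1.quotKerEquivRange.symm ⟨d1 p, p, rfl⟩) = _
    rw [this]; rfl
  have hτ : ∀ x, s x • e - x ∈ LinearMap.ker π := fun x => by
    rw [LinearMap.mem_ker, map_sub, map_smul, he, ← hs, ← Submodule.Quotient.mk_smul, smul_eq_mul,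
      mul_one, sub_self]
  let τ : P0 →ₗ[A] LinearMap.ker π :=
    (LinearMap.toSpanSingleton A P0 e ∘ₗ s - LinearMap.id).codRestrict _ hτ
  have hκ : ∀ j : J, (j : A) • e ∈ LinearMap.ker π := fun j => by
    rw [LinearMap.mem_ker, map_smul, he, ← Submodule.Quotient.mk_smul, smul_eq_mul,
      mul_one]
    exact (Submodule.Quotient.mk_eq_zero J).2 j.2
  let κ : J →ₗ[A] LinearMap.ker π :=
    (LinearMap.toSpanSingleton A P0 e ∘ₗ J.subtype).codRestrict _ hκ
  refine ⟨φ' ∘ₗ κ, φ' ∘ₗ τ, fun p => ?_⟩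
  have hp : d1 p ∈ LinearMap.ker π := h1.apply_apply_eq_zero p
  rw [← hφ' p hp]
  simp only [LinearMap.comp_apply]
  rw [← map_sub]
  congr 1

lemma alg_exact (d1 : P1 →ₗ[A] P0) (π : P0 →ₗ[A] (A ⧸ J)) (h1 : Function.Exact d1 π)
    (s : P0 →ₗ[A] A) (hs : ∀ x, Submodule.Quotient.mk (s x) = π x) (e : P0) (he : π e = Submodule.Quotient.mk 1)
    (h : J →ₗ[A] M) (ψ : P0 →ₗ[A] M)
    (H : ∀ p, ψ (d1 p) = h (sig d1 π h1 s hs p)) : ∃ m : M, ∀ j : J, h j = (j : A) • m := by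
  have hu : s e - 1 ∈ J := by
    rw [← Submodule.Quotient.mk_eq_zero J, Submodule.Quotient.mk_sub, hs, he, sub_self]
  refine ⟨ψ e - h ⟨_, hu⟩, fun j => ?_⟩
  have hj : π ((j : A) • e) = 0 := by
    rw [map_smul, he, ← Submodule.Quotient.mk_smul, smul_eq_mul, mul_one]
    exact (Submodule.Quotient.mk_eq_zero J).2 j.2
  obtain ⟨p, hp⟩ := (h1 _).1 hj
  have := H p
  have hs' : sig d1 π h1 s hs p = j + (j : A) • (⟨_, hu⟩ : J) := by
    apply Subtype.ext
    simp [sig, hp]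
    ring
  rw [hs', hp] at this
  simp only [map_add, map_smul] at this
  rw [smul_sub, this]
  abel

lemma alg_exact' (d1 : P1 →ₗ[A] P0) (π : P0 →ₗ[A] (A ⧸ J)) (h1 : Function.Exact d1 π)
    (s : P0 →ₗ[A] A) (hs : ∀ x, Submodule.Quotient.mk (s x) = π x)
    (m : M) : ∃ ψ : P0 →ₗ[A] M,
    ∀ p, ψ (d1 p) = (sig d1 π h1 s hs p : A) • m :=
  ⟨LinearMap.toSpanSingleton A M m ∘ₗ s, fun p => rfl⟩

lemma alg_nat (d1 : P1 →ₗ[A] P0) (π : P0 →ₗ[A] (A ⧸ J)) (h1 : Function.Exact d1 π)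
    (s : P0 →ₗ[A] A) (hs : ∀ x, Submodule.Quotient.mk (s x) = π x)
    {J' : Ideal A} {P0' P1' : Type} [AddCommGroup P0'] [Module A P0']
    [AddCommGroup P1'] [Module A P1'] (hJ : J' ≤ J)
    (d1' : P1' →ₗ[A] P0') (π' : P0' →ₗ[A] (A ⧸ J')) (h1' : Function.Exact d1' π')
    (s' : P0' →ₗ[A] A) (hs' : ∀ x, Submodule.Quotient.mk (s' x) = π' x)
    (g1 : P1' →ₗ[A] P1) (g0 : P0' →ₗ[A] P0) (hd : ∀ p, d1 (g1 p) = g0 (d1' p))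
    (hg : ∀ x, π (g0 x) = Submodule.mapQ J' J LinearMap.id hJ (π' x)) (h : J →ₗ[A] M) :
    ∃ ψ : P0' →ₗ[A] M, ∀ p, ψ (d1' p) = h (sig d1 π h1 s hs (g1 p)) -
      h (Submodule.inclusion hJ (sig d1' π' h1' s' hs' p)) := by
  have hτ : ∀ x, s (g0 x) - s' x ∈ J := fun x => by
    rw [← Submodule.Quotient.mk_eq_zero J, Submodule.Quotient.mk_sub, hs, hg, ← hs',
      Submodule.mapQ_apply, LinearMap.id_apply, sub_self]
  refine ⟨h ∘ₗ (s ∘ₗ g0 - s').codRestrict J hτ, fun p => ?_⟩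
  rw [← map_sub, LinearMap.comp_apply]
  congr 1
  apply Subtype.ext
  simp [sig, hd]

lemma alg0_zero (d1 : P1 →ₗ[A] P0) (π : P0 →ₗ[A] (A ⧸ J)) (h1 : Function.Exact d1 π)
    (e : P0) (he : π e = Submodule.Quotient.mk 1)
    (z : P0 →ₗ[A] M) (hz : ∀ p, z (d1 p) = 0) (h0 : z e = 0) : z = 0 := by
  ext x
  obtain ⟨a, ha⟩ := Submodule.Quotient.mk_surjective J (π x)
  have : π (x - a • e) = 0 := by
    rw [map_sub, map_smul, he, ← Submodule.Quotient.mk_smul, smul_eq_mul, mul_one, ha, sub_self]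
  obtain ⟨p, hp⟩ := (h1 _).1 this
  have h3 := hz p
  rw [hp, map_sub, map_smul, h0, smul_zero, sub_zero] at h3
  simpa using h3

lemma alg0_mem (d1 : P1 →ₗ[A] P0) (π : P0 →ₗ[A] (A ⧸ J)) (h1 : Function.Exact d1 π)
    (e : P0) (he : π e = Submodule.Quotient.mk 1)
    (z : P0 →ₗ[A] M) (hz : ∀ p, z (d1 p) = 0) (j : A) (hj : j ∈ J) : j • z e = 0 := by
  have : π (j • e) = 0 := by
    rw [map_smul, he, ← Submodule.Quotient.mk_smul, smul_eq_mul, mul_one]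
    exact (Submodule.Quotient.mk_eq_zero J).2 hj
  obtain ⟨p, hp⟩ := (h1 _).1 this
  rw [← map_smul, ← hp, hz]

lemma alg0_ex (d1 : P1 →ₗ[A] P0) (π : P0 →ₗ[A] (A ⧸ J)) (h1 : Function.Exact d1 π)
    (s : P0 →ₗ[A] A) (hs : ∀ x, Submodule.Quotient.mk (s x) = π x) (e : P0) (he : π e = Submodule.Quotient.mk 1)
    (m : M) (hm : ∀ j ∈ J, j • m = 0) : ∃ z : P0 →ₗ[A] M,
    (∀ p, z (d1 p) = 0) ∧ z e = m := by
  refine ⟨LinearMap.toSpanSingleton A M m ∘ₗ s, fun p => hm _ (sig d1 π h1 s hs p).2, ?_⟩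
  have hu : s e - 1 ∈ J := by
    rw [← Submodule.Quotient.mk_eq_zero J, Submodule.Quotient.mk_sub, hs, he, sub_self]
  have := hm _ hu
  rw [sub_smul, one_smul, sub_eq_zero] at this
  exact this

lemma alg0_nat (d1 : P1 →ₗ[A] P0) (π : P0 →ₗ[A] (A ⧸ J)) (h1 : Function.Exact d1 π)
    (e : P0)
    (z : P0 →ₗ[A] M) (hz : ∀ p, z (d1 p) = 0) (e' : P0) (h : π e' = π e) :
    z e' = z e := by
  have : π (e' - e) = 0 := by rw [map_sub, h, sub_self]
  obtain ⟨p, hp⟩ := (h1 _).1 this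
  rw [← sub_eq_zero, ← map_sub, ← hp, hz]

end alg

section data
variable {A : Type} [CommRing A]

/-- `Ext^n(A/J, M)`. -/
noncomputable abbrev E (n : ℕ) (J : Ideal A) (M : Type) [AddCommGroup M] [Module A M] :
    ModuleCat.{0} A :=
  ((Ext A (ModuleCat.{0} A) n).obj (op (ModuleCat.of A (A ⧸ J)))).obj (ModuleCat.of A M)

/-- The quotient map `A/J' → A/J`. -/
abbrev qmap {J' J : Ideal A} (hJ : J' ≤ J) :
    ModuleCat.of A (A ⧸ J') ⟶ ModuleCat.of A (A ⧸ J) :=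
  ModuleCat.ofHom (Submodule.mapQ J' J LinearMap.id hJ)

/-- The transition map of Ext. -/
noncomputable abbrev Etr (n : ℕ) {J' J : Ideal A} (hJ : J' ≤ J) (M : Type) [AddCommGroup M]
    [Module A M] : E n J M ⟶ E n J' M :=
  ((Ext A (ModuleCat.{0} A) n).map (qmap hJ).op).app (ModuleCat.of A M)

/-- Projective resolution together with lifts. -/
structure Res (J : Ideal A) where
  P : ProjectiveResolution (ModuleCat.of A (A ⧸ J))
  h2 : Function.Exact (P.complex.d 2 1).hom (P.complex.d 1 0).hom
  π : P.complex.X 0 →ₗ[A] (A ⧸ J)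
  hπ : π = (P.π.f 0).hom
  h1 : Function.Exact (P.complex.d 1 0).hom π
  s : P.complex.X 0 →ₗ[A] A
  hs : ∀ x, Submodule.Quotient.mk (s x) = π x
  e : P.complex.X 0
  he : π e = Submodule.Quotient.mk 1

lemma exists_res (J : Ideal A) : Nonempty (Res J) := by
  let P := projectiveResolution (ModuleCat.of A (A ⧸ J))
  let π : P.complex.X 0 →ₗ[A] (A ⧸ J) := (P.π.f 0).hom
  have hsurj : Function.Surjective π :=
    (ModuleCat.epi_iff_surjective (P.π.f 0)).1 inferInstance
  have h2 : Function.Exact (P.complex.d 2 1).hom (P.complex.d 1 0).hom :=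
    (ShortComplex.ShortExact.moduleCat_exact_iff_function_exact _).1 (P.exact_succ 0)
  have h1 : Function.Exact (P.complex.d 1 0).hom π :=
    (ShortComplex.ShortExact.moduleCat_exact_iff_function_exact _).1 P.exact₀
  have : Module.Projective A (P.complex.X 0) :=
    (IsProjective.iff_projective (R := A) _).2 (P.projective 0)
  obtain ⟨s, hs⟩ := Module.projective_lifting_property J.mkQ π J.mkQ_surjective
  obtain ⟨e, he⟩ := hsurj (Submodule.Quotient.mk 1)
  exact ⟨⟨P, h2, π, rfl, h1, s, fun x => LinearMap.congr_fun hs x, e, he⟩⟩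

variable {J J' : Ideal A} (M : Type) [AddCommGroup M] [Module A M] (R : Res J) (R' : Res J')

/-- The Hom complex. -/
noncomputable abbrev Res.K : CochainComplex (ModuleCat.{0} A) ℕ :=
  R.P.complex.linearYonedaObj A (ModuleCat.of A M)

/-- class in Ext of a cocycle -/
noncomputable def Res.c (n : ℕ) : Z (R.K M) n →ₗ[A] E n J M :=
  (R.P.isoExt (R := A) n (ModuleCat.of A M)).inv.hom ∘ₗ cls (R.K M) n

/-- the equivalence of homology with Ext -/
lemma Res.iso_inj (n : ℕ) :
    Function.Bijective (R.P.isoExt (R := A) n (ModuleCat.of A M)).inv.hom :=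
  ⟨(ModuleCat.mono_iff_injective _).1 inferInstance,
    (ModuleCat.epi_iff_surjective _).1 inferInstance⟩

lemma Res.c_surj (n : ℕ) : Function.Surjective (R.c M n) :=
  (R.iso_inj M n).2.comp (cls_surj _ n)

/-- cocycle from a linear map -/
noncomputable def Res.mkZ (n : ℕ) (φ : R.P.complex.X n →ₗ[A] M)
    (hφ : ∀ p, φ ((R.P.complex.d (n+1) n).hom p) = 0) : Z (R.K M) n :=
  ⟨(ModuleCat.ofHom φ : R.P.complex.X n ⟶ ModuleCat.of A M), 
    (ModuleCat.hom_ext (LinearMap.ext hφ) :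
      (R.P.complex.d (n+1) n ≫ (ModuleCat.ofHom φ : R.P.complex.X n ⟶ ModuleCat.of A M)) = 0)⟩

/-- linear map of a cocycle -/
noncomputable def Res.ofZ (n : ℕ) : Z (R.K M) n →ₗ[A] (R.P.complex.X n →ₗ[A] M) where
  toFun z := ModuleCat.Hom.hom (z.1 : R.P.complex.X n ⟶ ModuleCat.of A M)
  map_add' _ _ := rfl
  map_smul' _ _ := rfl

lemma Res.ofZ_d (n : ℕ) (z : Z (R.K M) n) (p) :
    R.ofZ M n z ((R.P.complex.d (n+1) n).hom p) = 0 := by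
  have := z.2
  rw [LinearMap.mem_ker] at this
  exact congrArg (fun f : R.P.complex.X (n+1) ⟶ ModuleCat.of A M => f.hom p) this

lemma Res.ofZ_inj (n : ℕ) : Function.Injective (R.ofZ M n) := fun z z' h => by
  apply Subtype.ext
  exact ModuleCat.hom_ext h

lemma Res.ofZ_mkZ (n : ℕ) (φ : R.P.complex.X n →ₗ[A] M) (hφ) : R.ofZ M n (R.mkZ M n φ hφ) = φ :=
  rfl

lemma Res.c_zero_iff (n : ℕ) (z : Z (R.K M) (n+1)) : R.c M (n+1) z = 0 ↔
    ∃ ψ : R.P.complex.X n →ₗ[A] M, ∀ p, ψ ((R.P.complex.d (n+1) n).hom p) = R.ofZ M (n+1) z p := by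
  have : R.c M (n+1) z = 0 ↔ cls (R.K M) (n+1) z = 0 := by
    unfold Res.c
    rw [LinearMap.comp_apply]
    exact map_eq_zero_iff _ (R.iso_inj M (n+1)).1
  rw [this, cls_zero_iff]
  constructor
  · rintro ⟨w, hw⟩
    exact ⟨ModuleCat.Hom.hom (w : R.P.complex.X n ⟶ ModuleCat.of A M), fun p =>
      congrArg (fun f : R.P.complex.X (n+1) ⟶ ModuleCat.of A M => f.hom p) hw⟩
  · rintro ⟨ψ, hψ⟩
    refine ⟨(ModuleCat.ofHom ψ : R.P.complex.X n ⟶ ModuleCat.of A M), ?_⟩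
    refine ModuleCat.hom_ext (LinearMap.ext hψ)

lemma Res.c0_inj : Function.Injective (R.c M 0) :=
  (R.iso_inj M 0).1.comp (cls_zero_inj _)

lemma Res.c_nat (hJ : J' ≤ J) (g : R'.P.complex ⟶ R.P.complex)
    (comm : g.f 0 ≫ R.P.π.f 0 = R'.P.π.f 0 ≫ qmap hJ) (n : ℕ) (z : Z (R.K M) n)
    (z' : Z (R'.K M) n) (h : R'.ofZ M n z' = R.ofZ M n z ∘ₗ (g.f n).hom) :
    (Etr n hJ M).hom (R.c M n z) = R'.c M n z' := by
  have h1 := isoExt_nat (qmap hJ) R'.P R.P g comm n (ModuleCat.of A M)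
  have h2 := congrArg (fun f => f.hom (cls (R.K M) n z)) h1
  refine h2.trans ?_
  have h3 := cls_nat (yonMap g (ModuleCat.of A M)) n z z' (ModuleCat.hom_ext h)
  exact congrArg (R'.P.isoExt (R := A) n (ModuleCat.of A M)).inv.hom h3

/-- The connecting map. -/
noncomputable def Res.δ : (J →ₗ[A] M) →ₗ[A] E 1 J M :=
  R.c M 1 ∘ₗ
  { toFun := fun h => R.mkZ M 1 (h ∘ₗ sig _ R.π R.h1 R.s R.hs) (fun p => by
      rw [LinearMap.comp_apply, sig_cocycle (P2 := R.P.complex.X 2) _ _ _ R.h2, map_zero])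
    map_add' := fun _ _ => rfl
    map_smul' := fun _ _ => rfl }

lemma Res.δ_surj : Function.Surjective (R.δ M) := by
  intro y
  obtain ⟨z, rfl⟩ := R.c_surj M 1 y
  obtain ⟨h, ψ, H⟩ := alg_surj _ _ R.π R.h2 R.h1 R.s R.hs R.e R.he (R.ofZ M 1 z) (R.ofZ_d M 1 z)
  refine ⟨h, ?_⟩
  rw [← sub_eq_zero]
  unfold Res.δ
  rw [LinearMap.comp_apply, ← map_sub, R.c_zero_iff M 0]
  exact ⟨ψ, fun p => H p⟩

lemma Res.δ_zero_iff (h : J →ₗ[A] M) : R.δ M h = 0 ↔ ∃ m : M, ∀ j : J, h j = (j : A) • m := by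
  unfold Res.δ
  rw [LinearMap.comp_apply, R.c_zero_iff M 0]
  constructor
  · rintro ⟨ψ, hψ⟩
    exact alg_exact _ R.π R.h1 R.s R.hs R.e R.he h ψ hψ
  · rintro ⟨m, hm⟩
    obtain ⟨ψ, hψ⟩ := alg_exact' _ R.π R.h1 R.s R.hs m
    exact ⟨ψ, fun p => (hψ p).trans (hm _).symm⟩

lemma exists_lift (hJ : J' ≤ J) : ∃ g : R'.P.complex ⟶ R.P.complex,
    g.f 0 ≫ R.P.π.f 0 = R'.P.π.f 0 ≫ qmap hJ :=
  ⟨ProjectiveResolution.lift (qmap hJ) R'.P R.P, ProjectiveResolution.lift_commutes_zero _ _ _⟩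

lemma Res.π_lift (hJ : J' ≤ J) (g : R'.P.complex ⟶ R.P.complex)
    (comm : g.f 0 ≫ R.P.π.f 0 = R'.P.π.f 0 ≫ qmap hJ) (x) :
    R.π ((g.f 0).hom x) = Submodule.mapQ J' J LinearMap.id hJ (R'.π x) := by
  rw [R.hπ, R'.hπ]
  exact congrArg (fun f => f.hom x) comm

/-- pullback of cocycles -/
lemma Res.exists_pull (g : R'.P.complex ⟶ R.P.complex) (n : ℕ) (z : Z (R.K M) n) :
    ∃ z' : Z (R'.K M) n, R'.ofZ M n z' = R.ofZ M n z ∘ₗ (g.f n).hom := by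
  refine ⟨R'.mkZ M n (R.ofZ M n z ∘ₗ (g.f n).hom) fun p => ?_, rfl⟩
  have : (g.f n).hom ((R'.P.complex.d (n+1) n).hom p) =
    (R.P.complex.d (n+1) n).hom ((g.f (n+1)).hom p) :=
    (congrArg (fun f => f.hom p) (g.comm (n+1) n)).symm
  rw [LinearMap.comp_apply, this, R.ofZ_d M]

lemma Res.δ_nat (hJ : J' ≤ J) (h : J →ₗ[A] M) :
    (Etr 1 hJ M).hom (R.δ M h) = R'.δ M (h ∘ₗ Submodule.inclusion hJ) := by
  obtain ⟨g, comm⟩ := exists_lift R R' hJ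
  unfold Res.δ
  rw [LinearMap.comp_apply, LinearMap.comp_apply]
  obtain ⟨z', hz'⟩ := R.exists_pull M R' g 1 (R.mkZ M 1 (h ∘ₗ sig _ R.π R.h1 R.s R.hs) (fun p => by
      rw [LinearMap.comp_apply, sig_cocycle (P2 := R.P.complex.X 2) _ _ _ R.h2, map_zero]))
  refine (R.c_nat M R' hJ g comm 1 _ z' hz').trans ?_
  rw [← sub_eq_zero, ← map_sub, R'.c_zero_iff M 0]
  obtain ⟨ψ, hψ⟩ := alg_nat _ R.π R.h1 R.s R.hs hJ _ R'.π R'.h1 R'.s R'.hs (g.f 1).hom (g.f 0).hom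
    (fun p => (congrArg (fun f => f.hom p) (g.comm 1 0))) (R.π_lift R' hJ g comm) h
  refine ⟨ψ, fun p => (hψ p).trans ?_⟩
  rw [map_sub, hz']
  rfl

/-- degree zero map -/
noncomputable def Res.ε : E 0 J M →ₗ[A] M :=
  (LinearMap.applyₗ R.e) ∘ₗ R.ofZ M 0 ∘ₗ
    (LinearEquiv.ofBijective (R.c M 0) ⟨R.c0_inj M, R.c_surj M 0⟩).symm.toLinearMap

lemma Res.ε_c (z : Z (R.K M) 0) : R.ε M (R.c M 0 z) = R.ofZ M 0 z R.e := by
  have : (LinearEquiv.ofBijective (R.c M 0) ⟨R.c0_inj M, R.c_surj M 0⟩).symm (R.c M 0 z) = z :=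
    (LinearEquiv.ofBijective (R.c M 0) ⟨R.c0_inj M, R.c_surj M 0⟩).symm_apply_apply z
  simp only [Res.ε, LinearMap.comp_apply, LinearEquiv.coe_coe]
  rw [this]
  rfl

lemma Res.ε_inj (y : E 0 J M) (h : R.ε M y = 0) : y = 0 := by
  obtain ⟨z, rfl⟩ := R.c_surj M 0 y
  rw [R.ε_c M] at h
  have : z = 0 := R.ofZ_inj M 0
    ((alg0_zero _ R.π R.h1 R.e R.he _ (R.ofZ_d M 0 z) h).trans (map_zero _).symm)
  rw [this, map_zero]

lemma Res.ε_range (m : M) : (∃ y, R.ε M y = m) ↔ ∀ j ∈ J, j • m = 0 := by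
  constructor
  · rintro ⟨y, rfl⟩ j hj
    obtain ⟨z, rfl⟩ := R.c_surj M 0 y
    rw [R.ε_c M]
    exact alg0_mem _ R.π R.h1 R.e R.he _ (R.ofZ_d M 0 z) j hj
  · intro hm
    obtain ⟨z, hz, rfl⟩ := alg0_ex _ R.π R.h1 R.s R.hs R.e R.he m hm
    exact ⟨R.c M 0 (R.mkZ M 0 z hz), R.ε_c M _⟩

lemma Res.ε_nat (hJ : J' ≤ J) (y : E 0 J M) : R'.ε M ((Etr 0 hJ M).hom y) = R.ε M y := by
  obtain ⟨g, comm⟩ := exists_lift R R' hJ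
  obtain ⟨z, rfl⟩ := R.c_surj M 0 y
  obtain ⟨z', hz'⟩ := R.exists_pull M R' g 0 z
  rw [R.c_nat M R' hJ g comm 0 z z' hz', R'.ε_c M, R.ε_c M, hz', LinearMap.comp_apply]
  refine alg0_nat _ R.π R.h1 R.e _ (R.ofZ_d M 0 z) _ ?_
  rw [R.π_lift R' hJ g comm, R'.he, R.he]
  rfl

end data

section colim
variable {A : Type} [CommRing A] (𝔞 : Ideal A) (M : Type) [AddCommGroup M] [Module A M] (n : ℕ)

/-- The diagram computing local cohomology of `M`. -/
noncomputable abbrev D : (ℕᵒᵖ)ᵒᵖ ⥤ ModuleCat.{0} A :=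
  localCohomology.diagram (localCohomology.idealPowersDiagram 𝔞) n ⋙
    (evaluation _ _).obj (ModuleCat.of A M)

/-- The colimit cocone with point the local cohomology of `M`. -/
noncomputable def Dc : Cocone (D 𝔞 M n) :=
  ((evaluation _ _).obj (ModuleCat.of A M)).mapCocone
    (colimit.cocone (localCohomology.diagram (localCohomology.idealPowersDiagram 𝔞) n))

/-- It is a colimit. -/
noncomputable def Dc_isColimit : IsColimit (Dc 𝔞 M n) :=
  isColimitOfPreserves _ (colimit.isColimit _)

/-- The canonical maps. -/
noncomputable def L (k : ℕ) : E n (𝔞 ^ k) M →ₗ[A] (localCohomology 𝔞 n).obj (ModuleCat.of A M) :=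
  ((Dc 𝔞 M n).ι.app (op (op k))).hom

lemma L_tr {k k' : ℕ} (h : k ≤ k') (x : E n (𝔞 ^ k) M) :
    L 𝔞 M n k' ((Etr n (Ideal.pow_le_pow_right h) M).hom x) = L 𝔞 M n k x :=
  congrArg (fun f => f.hom x) ((Dc 𝔞 M n).w (homOfLE h).op.op)

lemma L_surj (y : (localCohomology 𝔞 n).obj (ModuleCat.of A M)) : ∃ k x, L 𝔞 M n k x = y := by
  obtain ⟨j, x, hx⟩ := Concrete.isColimit_exists_rep (D 𝔞 M n) (Dc_isColimit 𝔞 M n) y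
  exact ⟨j.unop.unop, x, hx⟩

lemma L_zero (k : ℕ) (x : E n (𝔞 ^ k) M) (hx : L 𝔞 M n k x = 0) :
    ∃ (k' : ℕ) (h : k ≤ k'), (Etr n (Ideal.pow_le_pow_right h) M).hom x = 0 := by
  have h0 : (Dc 𝔞 M n).ι.app (op (op k)) x = (Dc 𝔞 M n).ι.app (op (op k)) (0 : E n (𝔞 ^ k) M) :=
    hx.trans (map_zero (L 𝔞 M n k)).symm
  obtain ⟨j, f, hf⟩ := ((Dc_isColimit 𝔞 M n).eq_iff' (i := op (op k)) x (0 : E n (𝔞 ^ k) M)).1 h0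
  refine ⟨j.unop.unop, leOfHom f.unop.unop, ?_⟩
  exact hf.trans (map_zero (Etr n (Ideal.pow_le_pow_right (leOfHom f.unop.unop)) M).hom)

lemma L_desc (g : ∀ k, E n (𝔞 ^ k) M →ₗ[A] M)
    (hg : ∀ k k' (h : k ≤ k') x,
      g k' ((Etr n (Ideal.pow_le_pow_right h) M).hom x) = g k x) :
    ∃ α : (localCohomology 𝔞 n).obj (ModuleCat.of A M) →ₗ[A] M,
      ∀ k x, α (L 𝔞 M n k x) = g k x := by
  let c : Cocone (D 𝔞 M n) :=
    { pt := ModuleCat.of A M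
      ι := { app := fun j => ModuleCat.ofHom (g j.unop.unop)
             naturality := fun j j' f =>
              ModuleCat.hom_ext (LinearMap.ext fun x => hg _ _ (leOfHom f.unop.unop) x) } }
  refine ⟨((Dc_isColimit 𝔞 M n).desc c).hom, fun k x => ?_⟩
  exact congrArg (fun f => f.hom x) ((Dc_isColimit 𝔞 M n).fac c (op (op k)))

end colim

end IdealTransformAux

/-- Let `A` be a commutative Noetherian ring, `𝔞 ⊆ A` an ideal and `M` an
`A`-module.  Let `T_𝔞(M) = colim_k Hom_A(𝔞^k, M)` be the ideal transform, the transition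
maps being restriction along the inclusions `𝔞^{k'} ⊆ 𝔞^k`.  Then there is an exact
sequence `0 → H⁰_𝔞(M) → M → T_𝔞(M) → H¹_𝔞(M) → 0` of `A`-modules, in which the map
`M → T_𝔞(M)` sends `m` to the compatible system of the restrictions to `𝔞^k` of `a ↦ a • m`. -/
theorem idealTransform_exact_sequence (A : Type) [CommRing A] [IsNoetherianRing A]
    (𝔞 : Ideal A) (M : Type) [AddCommGroup M] [Module A M] :
    ∃ (α : ↥((localCohomology 𝔞 0).obj (ModuleCat.of A M)) →ₗ[A] M)
      (β : M →ₗ[A] Module.DirectLimit (fun k : ℕ => ↥(𝔞 ^ k) →ₗ[A] M)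
        (fun k k' h => LinearMap.lcomp A M (Submodule.inclusion (Ideal.pow_le_pow_right h))))
      (γ : Module.DirectLimit (fun k : ℕ => ↥(𝔞 ^ k) →ₗ[A] M)
          (fun k k' h => LinearMap.lcomp A M (Submodule.inclusion (Ideal.pow_le_pow_right h)))
            →ₗ[A] ↥((localCohomology 𝔞 1).obj (ModuleCat.of A M))),
      (∀ (m : M) (k : ℕ),
        β m = Module.DirectLimit.of A ℕ (fun k : ℕ => ↥(𝔞 ^ k) →ₗ[A] M)
          (fun k k' h => LinearMap.lcomp A M (Submodule.inclusion (Ideal.pow_le_pow_right h)))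
          k (((LinearMap.lsmul A M).flip m) ∘ₗ (𝔞 ^ k).subtype)) ∧
      Function.Injective α ∧ Function.Exact α β ∧ Function.Exact β γ ∧
      Function.Surjective γ := by
  classical
  let G : ℕ → Type := fun k : ℕ => ↥(𝔞 ^ k) →ₗ[A] M
  let f : ∀ k k' : ℕ, k ≤ k' → G k →ₗ[A] G k' := fun k k' h =>
    LinearMap.lcomp A M (Submodule.inclusion (Ideal.pow_le_pow_right h))
  have : DirectedSystem G (fun k k' h => f k k' h) :=
    ⟨fun _ _ => rfl, fun _ _ _ _ _ _ => rfl⟩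
  let R : ∀ k : ℕ, IdealTransformAux.Res (𝔞 ^ k) := fun k =>
    (IdealTransformAux.exists_res (𝔞 ^ k)).some
  obtain ⟨α, hα⟩ := IdealTransformAux.L_desc 𝔞 M 0 (fun k => (R k).ε M)
    (fun k k' h x => (R k).ε_nat M (R k') _ x)
  let b : ∀ k : ℕ, M →ₗ[A] G k := fun k =>
    LinearMap.lcomp A M (𝔞 ^ k).subtype ∘ₗ (LinearMap.lsmul A M).flip
  let β : M →ₗ[A] Module.DirectLimit G f := Module.DirectLimit.of A ℕ G f 0 ∘ₗ b 0
  have hβ : ∀ m k, β m = Module.DirectLimit.of A ℕ G f k (b k m) := fun m k =>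
    (Module.DirectLimit.of_f (f := f) (hij := Nat.zero_le k) (x := b 0 m)).symm
  let γ : Module.DirectLimit G f →ₗ[A] ↥((localCohomology 𝔞 1).obj (ModuleCat.of A M)) :=
    Module.DirectLimit.lift A ℕ G f
      (fun k => IdealTransformAux.L 𝔞 M 1 k ∘ₗ (R k).δ M) (fun k k' h x => by
        rw [LinearMap.comp_apply, LinearMap.comp_apply, ← IdealTransformAux.L_tr 𝔞 M 1 h,
          (R k).δ_nat M (R k')]
        rfl)
  have hγ : ∀ k (x : G k), γ (Module.DirectLimit.of A ℕ G f k x) =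
      IdealTransformAux.L 𝔞 M 1 k ((R k).δ M x) := fun k x =>
    Module.DirectLimit.lift_of _ _ _
  refine ⟨α, β, γ, hβ, ?_, ?_, ?_, ?_⟩
  · refine (injective_iff_map_eq_zero α).2 fun y hy => ?_
    obtain ⟨k, x, rfl⟩ := IdealTransformAux.L_surj 𝔞 M 0 y
    rw [hα] at hy
    rw [(R k).ε_inj M x hy, map_zero]
  · intro m
    constructor
    · intro hm
      obtain ⟨k, hk, h0⟩ := Module.DirectLimit.of.zero_exact (f := f) hm
      obtain ⟨y, hy⟩ := ((R k).ε_range M m).2 fun j hj => LinearMap.congr_fun h0 ⟨j, hj⟩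
      exact ⟨IdealTransformAux.L 𝔞 M 0 k y, (hα k y).trans hy⟩
    · rintro ⟨y, rfl⟩
      obtain ⟨k, x, rfl⟩ := IdealTransformAux.L_surj 𝔞 M 0 y
      rw [hα, hβ _ k]
      have : b k ((R k).ε M x) = 0 :=
        LinearMap.ext fun j => ((R k).ε_range M _).1 ⟨x, rfl⟩ j.1 j.2
      rw [this, map_zero]
  · intro x
    constructor
    · intro hx
      obtain ⟨k, h, rfl⟩ := Module.DirectLimit.exists_of x
      rw [hγ] at hx
      obtain ⟨k', hk, h0⟩ := IdealTransformAux.L_zero 𝔞 M 1 k _ hx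
      rw [(R k).δ_nat M (R k'), (R k').δ_zero_iff M] at h0
      obtain ⟨m, hm⟩ := h0
      refine ⟨m, ?_⟩
      rw [hβ m k', ← Module.DirectLimit.of_f (f := f) (hij := hk) (x := h)]
      congr 1
      exact LinearMap.ext fun j => (hm j).symm
    · rintro ⟨m, rfl⟩
      rw [hβ m 0, hγ, ((R 0).δ_zero_iff M (b 0 m)).2 ⟨m, fun j => rfl⟩, map_zero]
  · intro y
    obtain ⟨k, x, rfl⟩ := IdealTransformAux.L_surj 𝔞 M 1 y
    obtain ⟨h, rfl⟩ := (R k).δ_surj M x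
    exact ⟨Module.DirectLimit.of A ℕ G f k h, hγ k h⟩
end

section
/- Let R be a commutative Noetherian ring and n ≥ 1. The canonical A-linear map Ext^n_A(A/I, A) → H^n_I(A), given by the structure morphism at k = 1 into the colimit colim_k Ext^n_A(A/I^k, A) defining local cohomology, is injective. -/
open CategoryTheory CategoryTheory.Limits Opposite MvPolynomial

namespace ExtLC
universe u

/-- Injectivity on homology from an elementwise criterion. -/
lemma mono_homologyMap {A : Type u} [Ring A] {S T : ShortComplex (ModuleCat.{u} A)} (φ : S ⟶ T)
    (h : ∀ x : S.X₂, S.g x = 0 → (∃ y : T.X₁, T.f y = φ.τ₂ x) → ∃ z : S.X₁, S.f z = x) :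
    Mono (ShortComplex.homologyMap φ) := by
  rw [ModuleCat.mono_iff_injective, injective_iff_map_eq_zero]
  intro a ha
  obtain ⟨c, rfl⟩ := (ModuleCat.epi_iff_surjective S.homologyπ).1 inferInstance a
  have h1 : T.homologyπ (ShortComplex.cyclesMap φ c) = 0 := by
    rw [← ConcreteCategory.comp_apply, ← ShortComplex.homologyπ_naturality,
      ConcreteCategory.comp_apply]
    exact ha
  have ex : (ShortComplex.mk _ _ T.toCycles_comp_homologyπ).Exact :=
    ShortComplex.exact_of_g_is_cokernel _ T.homologyIsCokernel
  obtain ⟨y, hy⟩ := (ShortComplex.moduleCat_exact_iff _).1 ex _ h1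
  have hy2 : T.f y = φ.τ₂ (S.iCycles c) := by
    rw [← ConcreteCategory.comp_apply, ← ShortComplex.cyclesMap_i, ConcreteCategory.comp_apply,
      ← hy, ← T.toCycles_i, ConcreteCategory.comp_apply]
  obtain ⟨z, hz⟩ := h (S.iCycles c) (by
    rw [← ConcreteCategory.comp_apply, S.iCycles_g]; rfl) ⟨y, hy2⟩
  have hc : c = S.toCycles z := by
    apply (ModuleCat.mono_iff_injective S.iCycles).1 inferInstance
    rw [← hz, ← ConcreteCategory.comp_apply, S.toCycles_i]
  rw [hc, ← ConcreteCategory.comp_apply, S.toCycles_comp_homologyπ]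
  rfl

lemma epi_homologyMap_of_unop {A : Type u} [Ring A] {S T : ShortComplex (ModuleCat.{u} A)ᵒᵖ}
    (φ : S ⟶ T) (h : Mono (ShortComplex.homologyMap (ShortComplex.unopMap φ))) :
    Epi (ShortComplex.homologyMap φ) := by
  have e := ShortComplex.homologyOpIso_hom_naturality (ShortComplex.unopMap φ)
  have h1 : Epi (ShortComplex.homologyMap (ShortComplex.unopMap φ)).op := inferInstance
  have h2 : Epi (ShortComplex.homologyMap (ShortComplex.opMap (ShortComplex.unopMap φ)) ≫
      (T.unop.homologyOpIso).hom) := by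
    rw [e]
    exact epi_comp _ _
  have h3 : ShortComplex.homologyMap (ShortComplex.opMap (ShortComplex.unopMap φ)) =
      (ShortComplex.homologyMap (ShortComplex.opMap (ShortComplex.unopMap φ)) ≫
      (T.unop.homologyOpIso).hom) ≫ (T.unop.homologyOpIso).inv := by simp
  change Epi (ShortComplex.homologyMap (ShortComplex.opMap (ShortComplex.unopMap φ)))
  rw [h3]
  exact epi_comp _ _

lemma ext_map_injective {A : Type u} [CommRing A] {X' X : ModuleCat.{u} A} (g : X' ⟶ X)
    (Y : ModuleCat.{u} A) (p : ℕ)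
    (h : ∀ x : Abelian.Ext X Y (p + 1), (Abelian.Ext.mk₀ g).comp x (zero_add _) = 0 → x = 0) :
    Function.Injective (((Ext A (ModuleCat.{u} A) (p + 1)).map g.op).app Y) := by
  let P' := projectiveResolution X'
  let P := projectiveResolution X
  let φ := ProjectiveResolution.lift g P' P
  let F := ((linearYoneda A (ModuleCat.{u} A)).obj Y).rightOp
  have hφ := ProjectiveResolution.lift_commutes g P' P
  have key : Epi ((F.mapHomologicalComplex _ ⋙ 
      HomologicalComplex.homologyFunctor _ (ComplexShape.down ℕ) (p+1)).map φ) := by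
    apply epi_homologyMap_of_unop
    apply mono_homologyMap
    intro x hx hy
    change P.complex.X (p + 1) ⟶ Y at x
    have hx' : P.complex.d (p + 2) (p + 1) ≫ x = 0 := by
      have hx0 : P.complex.d ((ComplexShape.down ℕ).prev (p + 1)) (p + 1) ≫ x = 0 := hx
      rwa [ChainComplex.prev] at hx0
    obtain ⟨y, hy⟩ := hy
    have hy' : ∃ y : P'.complex.X p ⟶ Y, P'.complex.d (p + 1) p ≫ y = φ.f (p + 1) ≫ x := by
      have hy0 : ∃ y : P'.complex.X ((ComplexShape.down ℕ).next (p + 1)) ⟶ Y,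
        P'.complex.d (p + 1) ((ComplexShape.down ℕ).next (p + 1)) ≫ y = φ.f (p + 1) ≫ x :=
        ⟨y, hy⟩
      rwa [ChainComplex.next_nat_succ] at hy0
    have hz : ∃ z : P.complex.X p ⟶ Y, P.complex.d (p + 1) p ≫ z = x := by
      rw [← P.extMk_eq_zero_iff x (p + 2) rfl hx' p rfl]
      apply h
      rw [ProjectiveResolution.mk₀_comp_extMk x (p + 2) rfl hx' 
        (φ := (⟨φ, ProjectiveResolution.lift_commutes_zero g P' P⟩ : 
          ProjectiveResolution.Hom P' P g))]
      exact (P'.extMk_eq_zero_iff _ (p + 2) rfl _ p rfl).2 hy'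
    have hz0 : ∃ z : P.complex.X ((ComplexShape.down ℕ).next (p + 1)) ⟶ Y,
        P.complex.d (p + 1) ((ComplexShape.down ℕ).next (p + 1)) ≫ z = x := by
      rwa [ChainComplex.next_nat_succ]
    exact hz0
  have e : Epi ((F.leftDerived (p+1)).map g) := by
    rw [Functor.leftDerived_map_eq F (p+1) g φ hφ]
    infer_instance
  rw [← ModuleCat.mono_iff_injective]
  exact (inferInstance : Mono ((F.leftDerived (p+1)).map g).unop)

lemma rees {A : Type u} [CommRing A] (rs : List A) : ∀ (N M : ModuleCat.{u} A) (i : ℕ),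
    RingTheory.Sequence.IsWeaklyRegular N rs → (∀ r ∈ rs, ∃ k : ℕ, ∀ m : M, r ^ k • m = 0) → 
    i < rs.length →
    ∀ x : Abelian.Ext M N i, x = 0 := by
  induction rs with
  | nil => intro N M i _ _ h; simp at h
  | cons r rs ih =>
    intro N M i hN hM hi x
    obtain ⟨h1, h2⟩ := (RingTheory.Sequence.isWeaklyRegular_cons_iff N r rs).1 hN
    have inj : ∀ x : Abelian.Ext M N i, r • x = 0 → x = 0 := by
      intro x hx
      rw [Abelian.Ext.smul_eq_comp_mk₀] at hx
      cases i with
      | zero =>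
        have : Mono (r • 𝟙 N) := h1.smulShortComplex_shortExact.mono_f
        apply Abelian.Ext.postcomp_mk₀_injective_of_mono M (r • 𝟙 N)
        simpa using hx
      | succ i =>
        obtain ⟨y, hy⟩ := Abelian.Ext.covariant_sequence_exact₁ M h1.smulShortComplex_shortExact
          x hx rfl
        have hy0 : y = 0 := ih (ModuleCat.of A (QuotSMulTop r N)) M i h2 (fun s hs => hM s (by simp [hs]))
          (by simpa using hi) y
        rw [← hy, hy0]
        exact Abelian.Ext.zero_comp _ _ h1.smulShortComplex_shortExact.extClass _ _
    obtain ⟨k, hk⟩ := hM r (by simp)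
    have hk0 : r ^ k • x = 0 := by
      have : r ^ k • (𝟙 M) = 0 := by ext m; exact hk m
      rw [← Abelian.Ext.mk₀_id_comp x, ← Abelian.Ext.smul_comp, ← Abelian.Ext.mk₀_smul, this]
      simp
    have : ∀ k : ℕ, r ^ k • x = 0 → x = 0 := by
      intro k
      induction k with
      | zero => simp
      | succ k ihk => 
        intro h
        rw [pow_succ', mul_smul] at h
        exact ihk (inj _ h)
    exact this k hk0

lemma regular_X (R : Type u) [CommRing R] (n : ℕ) : 
    RingTheory.Sequence.IsWeaklyRegular (MvPolynomial (Fin n) R)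
      (List.ofFn (X : Fin n → MvPolynomial (Fin n) R)) := by
  constructor
  intro i hi
  have hi' : i < n := by simpa using hi
  have e : (Ideal.ofList (List.take i (List.ofFn (X : Fin n → MvPolynomial (Fin n) R))) • 
      ⊤ : Submodule (MvPolynomial (Fin n) R) (MvPolynomial (Fin n) R)) = 
      Ideal.span (X '' {j : Fin n | j.1 < i}) := by
    rw [smul_eq_mul, Ideal.mul_top, Ideal.ofList]
    congr 1
    ext f
    simp [List.mem_take_iff_getElem]
    constructor
    · rintro ⟨j, hj, rfl⟩
      exact ⟨⟨j, by omega⟩, hj.1, rfl⟩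
    · rintro ⟨j, hj, rfl⟩
      exact ⟨j, ⟨hj, j.2⟩, rfl⟩
  rw [e]
  rw [isSMulRegular_quotient_iff_mem_of_smul_mem]
  intro f hf
  rw [List.getElem_ofFn, smul_eq_mul, mem_ideal_span_X_image] at hf
  rw [mem_ideal_span_X_image]
  intro m hm
  obtain ⟨j, hj, hmj⟩ := hf (Finsupp.single ⟨i, hi'⟩ 1 + m) (by
    rw [mem_support_iff, coeff_X_mul]
    exact mem_support_iff.1 hm)
  refine ⟨j, hj, ?_⟩
  have : (⟨i, hi'⟩ : Fin n) ≠ j := by rintro rfl; simp at hj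
  simpa [Finsupp.single_apply, this] using hmj


lemma ext_quot_zero (R : Type u) [CommRing R] (p : ℕ) 
    {Q' Q : ModuleCat.{u} (MvPolynomial (Fin (p+1)) R)} (g : Q' ⟶ Q) [Epi g] (k : ℕ)
    (hk : ∀ (i : Fin (p + 1)) (m : Q'), (X i : MvPolynomial (Fin (p+1)) R) ^ k • m = 0)
    (x : Abelian.Ext Q (ModuleCat.of (MvPolynomial (Fin (p+1)) R) (MvPolynomial (Fin (p+1)) R))
      (p + 1))
    (hx : (Abelian.Ext.mk₀ g).comp x (zero_add _) = 0) : x = 0 := by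
  have hS : (ShortComplex.mk (kernel.ι g) g (kernel.condition g)).ShortExact :=
    { exact := ShortComplex.exact_of_f_is_kernel _ (kernelIsKernel g) }
  obtain ⟨y, rfl⟩ := Abelian.Ext.contravariant_sequence_exact₃ hS _ x hx (add_comm 1 p)
  have hy := rees (List.ofFn (X : Fin (p+1) → MvPolynomial (Fin (p+1)) R)) (ModuleCat.of _ _)
    (kernel g) p (regular_X R (p+1)) (by
      intro r hr
      obtain ⟨i, rfl⟩ := (List.mem_ofFn' _ _).1 hr
      refine ⟨k, fun m => ?_⟩
      apply (ModuleCat.mono_iff_injective (kernel.ι g)).1 inferInstance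
      rw [map_smul, hk, map_zero]) (by simp) y
  rw [hy]
  exact Abelian.Ext.comp_zero hS.extClass _ _ _ _

end ExtLC

theorem ext_to_localCohomology_injective (R : Type) [CommRing R] [IsNoetherianRing R]
    (n : ℕ) (hn : 1 ≤ n) :
    haveI : HasColimit
        (localCohomology.diagram
          (localCohomology.idealPowersDiagram
            (Ideal.span (Set.range (X : Fin n → MvPolynomial (Fin n) R)))) n) :=
      localCohomology.hasColimitDiagram _ n
    Function.Injective
      ((colimit.ι
          (localCohomology.diagram
            (localCohomology.idealPowersDiagram
              (Ideal.span (Set.range (X : Fin n → MvPolynomial (Fin n) R)))) n)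
          (op (op (1 : ℕ)))).app
        (ModuleCat.of (MvPolynomial (Fin n) R) (MvPolynomial (Fin n) R))) := by
  obtain ⟨p, rfl⟩ : ∃ p, n = p + 1 := ⟨n - 1, by omega⟩
  have hcol := localCohomology.hasColimitDiagram
    (localCohomology.idealPowersDiagram
      (Ideal.span (Set.range (X : Fin (p + 1) → MvPolynomial (Fin (p + 1)) R)))) (p + 1)
  intro a b hab
  obtain ⟨k, f, f', hf⟩ := Concrete.isColimit_exists_of_rep_eq _
    (isColimitOfPreserves ((evaluation _ _).obj
      (ModuleCat.of (MvPolynomial (Fin (p + 1)) R) (MvPolynomial (Fin (p + 1)) R)))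
      (colimit.isColimit (localCohomology.diagram
        (localCohomology.idealPowersDiagram
          (Ideal.span (Set.range (X : Fin (p + 1) → MvPolynomial (Fin (p + 1)) R)))) (p + 1))))
    (i := op (op 1)) (j := op (op 1)) a b hab
  obtain rfl : f = f' := Subsingleton.elim _ _
  refine ExtLC.ext_map_injective _ _ p ?_ hf
  have : Epi ((localCohomology.ringModIdeals (localCohomology.idealPowersDiagram
      (Ideal.span (Set.range (X : Fin (p + 1) → MvPolynomial (Fin (p + 1)) R))))).map f.unop) := by
    rw [ModuleCat.epi_iff_surjective]
    intro y
    obtain ⟨y, rfl⟩ := Submodule.Quotient.mk_surjective _ y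
    exact ⟨Submodule.Quotient.mk y, rfl⟩
  apply ExtLC.ext_quot_zero R p _ k.unop.unop
  intro i m
  obtain ⟨m, rfl⟩ := Submodule.Quotient.mk_surjective _ m
  refine (Submodule.Quotient.mk_eq_zero _ (x := X i ^ k.unop.unop • m)).2 ?_
  exact Ideal.mul_mem_right _ _ (Ideal.pow_mem_pow (Ideal.subset_span (Set.mem_range_self i)) _)
end

section
/- Let k be a field of characteristic zero, m ≥ 2, and n = 2m+1 (so n ≥ 5 is odd). Let R = k[x₁,…,xₙ], f = x₁²+⋯+xₙ², and for p ∈ ℕ let G_p be the cokernel of the map R^{≥p−m} → R^{≥p−m+1} given by multiplication by f. Then: (i) Ext^j_R(G_p, R) = 0 for every natural number j ∉ {1, n−1, n}; (ii) Ext^1_R(G_p, R) is isomorphic to R/(f) as an R-module; (iii) Ext^{n−1}_R(G_p, R) is isomorphic, as a k-vector space, to the k-linear dual of the image in R/(f) of the space of polynomials of degree ≤ p−m (this image being zero when p < m); (iv) Ext^n_R(G_p, R) is isomorphic, as a k-vector space, to the k-linear dual of the space of homogeneous polynomials of degree p−m−1 in R (zero when p ≤ m). -/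
open CategoryTheory Opposite MvPolynomial

noncomputable section

/-- The ideal `R^{≥q} = 𝔪^{max(q,0)}` of polynomials spanned by monomials of degree `≥ q`,
where `𝔪 = (x₁,…,xₙ)`. -/
def degGE (K : Type) [CommRing K] (n : ℕ) (q : ℤ) : Ideal (MvPolynomial (Fin n) K) :=
  (Ideal.span (Set.range (X : Fin n → MvPolynomial (Fin n) K))) ^ q.toNat

/-- The quadric `f = x₁² + ⋯ + xₙ²`. -/
def quadricSum (K : Type) [CommRing K] (n : ℕ) : MvPolynomial (Fin n) K :=
  ∑ i : Fin n, X i ^ 2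

lemma quadricSum_mem_sq (K : Type) [CommRing K] (n : ℕ) :
    quadricSum K n ∈ (Ideal.span (Set.range (X : Fin n → MvPolynomial (Fin n) K))) ^ 2 := by
  refine Ideal.sum_mem _ fun i _ => ?_
  have hXi : (X i : MvPolynomial (Fin n) K) ∈
      Ideal.span (Set.range (X : Fin n → MvPolynomial (Fin n) K)) :=
    Ideal.subset_span ⟨i, rfl⟩
  exact Ideal.pow_mem_pow hXi 2

lemma quadricSum_smul_mem (K : Type) [CommRing K] (n : ℕ) {q s : ℤ}
    (h : s.toNat ≤ q.toNat + 2) :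
    ∀ x ∈ degGE K n q,
      (LinearMap.lsmul (MvPolynomial (Fin n) K) (MvPolynomial (Fin n) K)
        (quadricSum K n)) x ∈ degGE K n s := by
  intro x hx
  simp only [LinearMap.lsmul_apply, smul_eq_mul]
  have h2 : quadricSum K n * x ∈
      (Ideal.span (Set.range (X : Fin n → MvPolynomial (Fin n) K))) ^ (2 + q.toNat) := by
    rw [pow_add]
    exact Ideal.mul_mem_mul (quadricSum_mem_sq K n) hx
  exact Ideal.pow_le_pow_right (by omega) h2

/-- Multiplication by `f` as map `R^{≥q} → R^{≥s}` (for `s ≤ q + 2`). -/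
def quadricMulMap (K : Type) [CommRing K] (n : ℕ) (q s : ℤ) (h : s.toNat ≤ q.toNat + 2) :
    ↥(degGE K n q) →ₗ[MvPolynomial (Fin n) K] ↥(degGE K n s) :=
  (LinearMap.lsmul (MvPolynomial (Fin n) K) (MvPolynomial (Fin n) K)
    (quadricSum K n)).restrict (quadricSum_smul_mem K n h)

/-- Odd-dimensional case: `G_p`, the cokernel of `f : R^{≥p−m} → R^{≥p−m+1}`, i.e. the
graded piece `Gr^F_p M` for the intersection cohomology Hodge module of the quadric cone. -/
def quadricGradedOdd (K : Type) [CommRing K] (m : ℕ) (p : ℕ) : Type :=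
  ↥(degGE K (2 * m + 1) ((p : ℤ) - m + 1)) ⧸
    LinearMap.range (quadricMulMap K (2 * m + 1) ((p : ℤ) - m) ((p : ℤ) - m + 1) (by omega))

instance (K : Type) [CommRing K] (m p : ℕ) : AddCommGroup (quadricGradedOdd K m p) :=
  inferInstanceAs (AddCommGroup (_ ⧸ _))

instance (K : Type) [CommRing K] (m p : ℕ) :
    Module (MvPolynomial (Fin (2 * m + 1)) K) (quadricGradedOdd K m p) :=
  inferInstanceAs (Module _ (_ ⧸ _))

/-- `Ext^j_R(G_p, R)` in the odd case. -/
def quadricExtOdd (K : Type) [CommRing K] (m : ℕ) (p : ℕ) (j : ℕ) :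
    ModuleCat (MvPolynomial (Fin (2 * m + 1)) K) :=
  ((Ext (MvPolynomial (Fin (2 * m + 1)) K) (ModuleCat (MvPolynomial (Fin (2 * m + 1)) K)) j).obj
      (op (ModuleCat.of (MvPolynomial (Fin (2 * m + 1)) K) (quadricGradedOdd K m p)))).obj
    (ModuleCat.of (MvPolynomial (Fin (2 * m + 1)) K) (MvPolynomial (Fin (2 * m + 1)) K))

/-- The image in `R/(f)` of the polynomials of total degree `≤ d`, as a `K`-subspace. -/
def imageLowDegree (K : Type) [Field K] (n : ℕ) (d : ℕ) :
    Submodule K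
      (MvPolynomial (Fin n) K ⧸ Ideal.span {quadricSum K n}) :=
  Submodule.map (Ideal.Quotient.mkₐ K (Ideal.span {quadricSum K n})).toLinearMap
    (restrictTotalDegree (Fin n) K d)


theorem extMk_smul_aux {R : Type} [CommRing R] (X Y : ModuleCat.{0} R) (P : ProjectiveResolution X)
    (j : ℕ) (f : P.complex.X j ⟶ Y) (hf : P.complex.d (j+1) j ≫ f = 0) (r : R) :
    P.extMk (r • f) (j+1) rfl (by rw [Linear.comp_smul, hf, smul_zero]) =
      r • P.extMk f (j+1) rfl hf := by
  rw [Abelian.Ext.smul_eq_comp_mk₀, P.extMk_comp_mk₀]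
  congr 1

theorem extCompare_map {R : Type} [CommRing R] (X Y : ModuleCat.{0} R) (P : ProjectiveResolution X)
    (i j : ℕ) :
    ∃ φ : (LinearMap.ker ((P.complex.linearYonedaObj R Y).sc' i j (j+1)).g.hom) →ₗ[R]
        Abelian.Ext X Y j,
      Function.Surjective φ ∧ ∀ x, φ x = P.extMk (x.1 : P.complex.X j ⟶ Y) (j+1) rfl x.2 := by
  refine ⟨{ toFun := fun x => P.extMk (x.1 : P.complex.X j ⟶ Y) (j+1) rfl x.2
            map_add' := ?_
            map_smul' := ?_}, ?_, fun x => rfl⟩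
  · intro x y
    exact (P.add_extMk _ _ _ _ _ _).symm
  · intro r x
    exact extMk_smul_aux X Y P j x.1 x.2 r
  · intro α
    obtain ⟨f, hf, rfl⟩ := P.extMk_surjective α (j+1) rfl
    exact ⟨⟨f, hf⟩, rfl⟩

theorem extMk_zero_iff' {R : Type} [CommRing R] (X Y : ModuleCat.{0} R) (P : ProjectiveResolution X) 
    (f : P.complex.X 0 ⟶ Y) (hf : P.complex.d 1 0 ≫ f = 0) :
    P.extMk f 1 rfl hf = 0 ↔ f = 0 := by
  refine ⟨fun h => ?_, fun h => by subst h; simp⟩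
  simp only [← P.extEquivCohomologyClass.apply_eq_iff_eq,
    ProjectiveResolution.extEquivCohomologyClass_extMk, ProjectiveResolution.extEquivCohomologyClass_zero,
    CochainComplex.HomComplex.CohomologyClass.mk_eq_zero_iff] at h
  rw [CochainComplex.HomComplex.Cocycle.toSingleMk_mem_coboundaries_iff _ _ _ _ _ 1 (by lia)] at h
  obtain ⟨g, hg⟩ := h
  have h0 : g = 0 := by
    apply Limits.IsZero.eq_of_src
    exact P.cochainComplex.isZero_of_isStrictlyLE 0 1 (by lia)
  subst h0
  rw [Limits.comp_zero] at hg
  rw [← cancel_epi (P.cochainComplexXIso (-(0:ℕ)) 0 rfl).hom, Limits.comp_zero]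
  exact hg.symm

theorem extCompare {R : Type} [CommRing R] (X Y : ModuleCat.{0} R) (j : ℕ) :
    Nonempty ((((Ext R (ModuleCat.{0} R) j).obj (op X)).obj Y) ≃ₗ[R] Abelian.Ext X Y j) := by
  let P := projectiveResolution X
  let K := P.complex.linearYonedaObj R Y
  let e1 : (((Ext R (ModuleCat.{0} R) j).obj (op X)).obj Y) ≅ K.homology j := P.isoExt j Y
  obtain ⟨i, hi⟩ : ∃ i, (ComplexShape.up ℕ).prev j = i := ⟨_, rfl⟩
  let S := K.sc' i j (j+1)
  let e2 : K.homology j ≅ S.homology :=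
    ShortComplex.homologyMapIso (K.isoSc' i j (j+1) hi (by simp))
  let e3 := S.moduleCatHomologyIso
  obtain ⟨φ, hφ, hφ2⟩ := extCompare_map X Y P i j
  have hk : LinearMap.range S.moduleCatToCycles = LinearMap.ker φ := by
    ext x
    rw [LinearMap.mem_ker, hφ2, LinearMap.mem_range]
    rcases j with _ | j
    · refine Iff.trans ?_ (extMk_zero_iff' X Y P _ _).symm
      have hd : K.d i 0 = 0 := by
        apply K.shape
        simp
      constructor
      · rintro ⟨y, rfl⟩
        exact LinearMap.congr_fun (congrArg ModuleCat.Hom.hom hd) y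
      · intro h
        refine ⟨0, ?_⟩
        rw [map_zero]
        exact Subtype.ext h.symm
    · have : i = j := by
        rw [← hi]; simp
      subst this
      refine Iff.trans ?_ (P.extMk_eq_zero_iff _ _ _ _ i rfl).symm
      constructor
      · rintro ⟨y, rfl⟩
        exact ⟨y, rfl⟩
      · rintro ⟨y, hy⟩
        exact ⟨y, Subtype.ext hy⟩
  have e4 : S.moduleCatLeftHomologyData.H ≃ₗ[R] Abelian.Ext X Y j :=
    (Submodule.quotEquivOfEq _ _ hk).trans (φ.quotKerEquivOfSurjective hφ)
  exact ⟨((e1 ≪≫ e2 ≪≫ e3).toLinearEquiv).trans e4⟩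

/-- `Ext^j_R(M, R)` in the derived-category sense. -/
abbrev EE (R : Type) [CommRing R] (M : Type) [AddCommGroup M] [Module R M] (j : ℕ) : Type :=
  Abelian.Ext.{0} (ModuleCat.of R M) (ModuleCat.of R R) j

/-- The long exact sequence. -/
theorem ee_les {R : Type} [CommRing R] {M N P : Type} [AddCommGroup M] [Module R M]
    [AddCommGroup N] [Module R N] [AddCommGroup P] [Module R P]
    (f : M →ₗ[R] N) (g : N →ₗ[R] P) (hf : Function.Injective f) (hg : Function.Surjective g)
    (hfg : Function.Exact f g) :
    ∃ (fs : ∀ j, EE R N j →ₗ[R] EE R M j) (gs : ∀ j, EE R P j →ₗ[R] EE R N j)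
      (δ : ∀ j, EE R M j →ₗ[R] EE R P (j+1)),
      (∀ j, fs j = (Abelian.Ext.mk₀ (ModuleCat.ofHom f)).precompOfLinear R (ModuleCat.of R R)
        (zero_add j)) ∧
      (∀ j, Function.Exact (gs j) (fs j)) ∧ (∀ j, Function.Exact (fs j) (δ j)) ∧
      (∀ j, Function.Exact (δ j) (gs (j+1))) ∧ Function.Injective (gs 0) := by
  let S : ShortComplex (ModuleCat.{0} R) := ShortComplex.mk (ModuleCat.ofHom f) (ModuleCat.ofHom g)
    (by ext x; exact hfg.apply_apply_eq_zero x)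
  have hS : S.ShortExact :=
    { exact := by
        rw [ShortComplex.ShortExact.moduleCat_exact_iff_function_exact]
        exact hfg
      mono_f := (ModuleCat.mono_iff_injective _).2 hf
      epi_g := (ModuleCat.epi_iff_surjective _).2 hg }
  refine ⟨fun j => (Abelian.Ext.mk₀ S.f).precompOfLinear R (ModuleCat.of R R) (zero_add j),
    fun j => (Abelian.Ext.mk₀ S.g).precompOfLinear R (ModuleCat.of R R) (zero_add j),
    fun j => hS.extClass.precompOfLinear R (ModuleCat.of R R) (add_comm 1 j), fun j => rfl,
    fun j x => ⟨fun hx => Abelian.Ext.contravariant_sequence_exact₂ hS _ x hx, ?_⟩,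
    fun j x => ⟨fun hx => Abelian.Ext.contravariant_sequence_exact₁ hS _ x (add_comm 1 j) hx, ?_⟩,
    fun j x => ⟨fun hx => Abelian.Ext.contravariant_sequence_exact₃ hS _ x hx (add_comm 1 j), ?_⟩, ?_⟩
  · rintro ⟨y, rfl⟩
    simp
  · rintro ⟨y, rfl⟩
    simp
  · rintro ⟨y, rfl⟩
    simp
  · have := hS.epi_g
    exact Abelian.Ext.precomp_mk₀_injective_of_epi (ModuleCat.of R R) S.g

section LES
variable {R : Type} [CommRing R] {M N P : Type} [AddCommGroup M] [Module R M]
    [AddCommGroup N] [Module R N] [AddCommGroup P] [Module R P]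

theorem exact_sub_mid {A B C : Type} [AddCommGroup A] [AddCommGroup B] [AddCommGroup C]
    [Module R A] [Module R B] [Module R C] {u : A →ₗ[R] B} {v : B →ₗ[R] C}
    (h : Function.Exact u v) (hA : Subsingleton A) (hC : Subsingleton C) : Subsingleton B := by
  refine subsingleton_of_forall_eq 0 fun b => ?_
  obtain ⟨a, rfl⟩ := (h b).1 (Subsingleton.elim _ _)
  rw [Subsingleton.elim a 0, map_zero]

theorem exact_equiv {A B C D : Type} [AddCommGroup A] [AddCommGroup B] [AddCommGroup C]
    [AddCommGroup D] [Module R A] [Module R B] [Module R C] [Module R D]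
    {u : A →ₗ[R] B} {v : B →ₗ[R] C} {w : C →ₗ[R] D}
    (h : Function.Exact u v) (h' : Function.Exact v w) (hA : Subsingleton A)
    (hD : Subsingleton D) : Nonempty (B ≃ₗ[R] C) := by
  refine ⟨LinearEquiv.ofBijective v ⟨?_, ?_⟩⟩
  · rw [injective_iff_map_eq_zero]
    intro b hb
    obtain ⟨a, rfl⟩ := (h b).1 hb
    rw [Subsingleton.elim a 0, map_zero]
  · intro c
    exact (h' c).1 (Subsingleton.elim _ _)

theorem ee_mid (f : M →ₗ[R] N) (g : N →ₗ[R] P) (hf : Function.Injective f) (hg : Function.Surjective g)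
    (hfg : Function.Exact f g)
    (j : ℕ) (hM : Subsingleton (EE R M j)) (hP : Subsingleton (EE R P j)) :
    Subsingleton (EE R N j) := by
  obtain ⟨fs, gs, δ, -, h1, h2, h3, h4⟩ := ee_les f g hf hg hfg
  exact exact_sub_mid (h1 j) hP hM

theorem ee_right_zero (f : M →ₗ[R] N) (g : N →ₗ[R] P) (hf : Function.Injective f) (hg : Function.Surjective g)
    (hfg : Function.Exact f g)
    (hN : Subsingleton (EE R N 0)) : Subsingleton (EE R P 0) := by
  obtain ⟨fs, gs, δ, -, h1, h2, h3, h4⟩ := ee_les f g hf hg hfg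
  exact h4.subsingleton

theorem ee_right (f : M →ₗ[R] N) (g : N →ₗ[R] P) (hf : Function.Injective f) (hg : Function.Surjective g)
    (hfg : Function.Exact f g)
    (j : ℕ) (hM : Subsingleton (EE R M j)) (hN : Subsingleton (EE R N (j+1))) :
    Subsingleton (EE R P (j+1)) := by
  obtain ⟨fs, gs, δ, -, h1, h2, h3, h4⟩ := ee_les f g hf hg hfg
  exact exact_sub_mid (h3 j) hM hN

theorem ee_left (f : M →ₗ[R] N) (g : N →ₗ[R] P) (hf : Function.Injective f) (hg : Function.Surjective g)
    (hfg : Function.Exact f g)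
    (j : ℕ) (hN : Subsingleton (EE R N j)) (hP : Subsingleton (EE R P (j+1))) :
    Subsingleton (EE R M j) := by
  obtain ⟨fs, gs, δ, -, h1, h2, h3, h4⟩ := ee_les f g hf hg hfg
  exact exact_sub_mid (h2 j) hN hP

theorem ee_equiv_right_mid (f : M →ₗ[R] N) (g : N →ₗ[R] P) (hf : Function.Injective f) (hg : Function.Surjective g)
    (hfg : Function.Exact f g)
    (j : ℕ) (hM : Subsingleton (EE R M j))
    (hM' : Subsingleton (EE R M (j+1))) : Nonempty (EE R P (j+1) ≃ₗ[R] EE R N (j+1)) := by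
  obtain ⟨fs, gs, δ, -, h1, h2, h3, h4⟩ := ee_les f g hf hg hfg
  exact exact_equiv (h3 j) (h1 (j+1)) hM hM'

theorem ee_equiv_mid_left (f : M →ₗ[R] N) (g : N →ₗ[R] P) (hf : Function.Injective f) (hg : Function.Surjective g)
    (hfg : Function.Exact f g)
    (j : ℕ) (hP : Subsingleton (EE R P j))
    (hP' : Subsingleton (EE R P (j+1))) : Nonempty (EE R N j ≃ₗ[R] EE R M j) := by
  obtain ⟨fs, gs, δ, -, h1, h2, h3, h4⟩ := ee_les f g hf hg hfg
  exact exact_equiv (h1 j) (h2 j) hP hP'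

theorem ee_equiv_left_right (f : M →ₗ[R] N) (g : N →ₗ[R] P) (hf : Function.Injective f) (hg : Function.Surjective g)
    (hfg : Function.Exact f g)
    (j : ℕ) (hN : Subsingleton (EE R N j))
    (hN' : Subsingleton (EE R N (j+1))) : Nonempty (EE R M j ≃ₗ[R] EE R P (j+1)) := by
  obtain ⟨fs, gs, δ, -, h1, h2, h3, h4⟩ := ee_les f g hf hg hfg
  exact exact_equiv (h2 j) (h3 j) hN hN'

end LES

theorem ee_congr {R : Type} [CommRing R] {M N : Type} [AddCommGroup M] [Module R M]
    [AddCommGroup N] [Module R N] (e : M ≃ₗ[R] N) (j : ℕ) : Nonempty (EE R M j ≃ₗ[R] EE R N j) := by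
  have h1 : (ModuleCat.ofHom e.toLinearMap : ModuleCat.of R M ⟶ ModuleCat.of R N) ≫
      ModuleCat.ofHom e.symm.toLinearMap = 𝟙 _ := by ext x; simp
  have h2 : (ModuleCat.ofHom e.symm.toLinearMap : ModuleCat.of R N ⟶ ModuleCat.of R M) ≫
      ModuleCat.ofHom e.toLinearMap = 𝟙 _ := by ext x; simp
  exact ⟨LinearEquiv.ofLinearMap
    ((Abelian.Ext.mk₀ (ModuleCat.ofHom e.symm.toLinearMap)).precompOfLinear R _ (zero_add j))
    ((Abelian.Ext.mk₀ (ModuleCat.ofHom e.toLinearMap)).precompOfLinear R _ (zero_add j))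
    (by ext x; simp [h2]) (by ext x; simp [h1])⟩

/-- `M` is self-dual in codimension `i`. -/
def SelfDualExt (R : Type) [CommRing R] (M : Type) [AddCommGroup M] [Module R M] (i : ℕ) : Prop :=
  (∀ j, j ≠ i → Subsingleton (EE R M j)) ∧ Nonempty (EE R M i ≃ₗ[R] M)

theorem selfDual_congr {R : Type} [CommRing R] {M N : Type} [AddCommGroup M] [Module R M]
    [AddCommGroup N] [Module R N] (e : M ≃ₗ[R] N) {i : ℕ} (h : SelfDualExt R M i) :
    SelfDualExt R N i := by
  refine ⟨fun j hj => ?_, ?_⟩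
  · have := h.1 j hj
    obtain ⟨e'⟩ := ee_congr e j
    exact e'.symm.injective.subsingleton
  · obtain ⟨e'⟩ := ee_congr e i
    obtain ⟨e''⟩ := h.2
    exact ⟨e'.symm.trans (e''.trans e)⟩

theorem selfDual_base (R : Type) [CommRing R] : SelfDualExt R R 0 := by
  have : Projective (ModuleCat.of R R) := inferInstance
  refine ⟨fun j hj => ?_, ?_⟩
  · obtain ⟨j, rfl⟩ := Nat.exists_eq_succ_of_ne_zero hj
    exact Abelian.Ext.subsingleton_of_projective _ _ _
  · exact ⟨(Abelian.Ext.linearEquiv₀ (R := R)).trans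
      ((ModuleCat.homLinearEquiv (S := R)).trans (LinearMap.ringLmapEquivSelf R R R))⟩

theorem selfDual_step {R : Type} [CommRing R] {M P : Type} [AddCommGroup M] [Module R M]
    [AddCommGroup P] [Module R P] (x : R) (g : M →ₗ[R] P)
    (hx : ∀ v : M, x • v = 0 → v = 0) (hg : Function.Surjective g)
    (hxg : ∀ v : M, g v = 0 ↔ ∃ w, x • w = v) {i : ℕ} (h : SelfDualExt R M i) :
    SelfDualExt R P (i+1) := by
  let f : M →ₗ[R] M := x • LinearMap.id
  have hf : Function.Injective f := (injective_iff_map_eq_zero f).2 fun v hv => hx v hv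
  have hfg : Function.Exact f g := fun v => hxg v
  obtain ⟨fs, gs, δ, h0, h1, h2, h3, h4⟩ := ee_les f g hf hg hfg
  have hfs : ∀ j, ∀ a : EE R M j, fs j a = x • a := by
    intro j a
    rw [h0]
    have : (ModuleCat.ofHom f : ModuleCat.of R M ⟶ ModuleCat.of R M) = x • 𝟙 _ := by
      ext; rfl
    rw [this, Abelian.Ext.mk₀_smul]
    simp
  obtain ⟨e⟩ := h.2
  have hinj : ∀ j, Function.Injective (fs j) := by
    intro j
    by_cases hj : j = i
    · subst hj
      rw [injective_iff_map_eq_zero]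
      intro a ha
      rw [hfs] at ha
      apply e.injective
      rw [map_zero]
      apply hx
      rw [← map_smul, ha, map_zero]
    · have := h.1 j hj
      exact Function.injective_of_subsingleton _
  have hgs : ∀ j, ∀ a, gs j a = 0 := by
    intro j a
    apply hinj j
    rw [map_zero]
    exact (h1 j _).2 ⟨a, rfl⟩
  have hδ : ∀ j, Function.Surjective (δ j) := fun j a => (h3 j a).1 (hgs _ a)
  refine ⟨fun j hj => ?_, ?_⟩
  · rcases j with _ | j
    · exact subsingleton_of_forall_eq 0 fun a => h4 (by rw [hgs, map_zero])
    · have := h.1 j (by omega)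
      exact (hδ j).subsingleton
  · have k1 : LinearMap.range (fs i) = LinearMap.ker (δ i) := by
      ext a; exact (h2 i a).symm
    have k2 : Submodule.map e.toLinearMap (LinearMap.ker (δ i)) = LinearMap.ker g := by
      rw [← k1]
      ext v
      constructor
      · rintro ⟨_, ⟨a, rfl⟩, rfl⟩
        rw [hfs]
        exact (hxg _).2 ⟨e a, by simp⟩
      · intro hv
        obtain ⟨w, rfl⟩ := (hxg _).1 hv
        exact ⟨_, ⟨e.symm w, rfl⟩, by rw [hfs]; simp⟩
    exact ⟨((δ i).quotKerEquivOfSurjective (hδ i)).symm.trans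
      ((Submodule.Quotient.equiv _ _ e k2).trans (g.quotKerEquivOfSurjective hg))⟩

/-- The ideal generated by the first `i` variables. -/
noncomputable def varIdeal (k : Type) [Field k] (n i : ℕ) : Ideal (MvPolynomial (Fin n) k) :=
  Ideal.span (X '' {j : Fin n | j.val < i})

theorem mem_varIdeal_of_mul (k : Type) [Field k] (n : ℕ) (i : Fin n)
    (p : MvPolynomial (Fin n) k) (h : X i * p ∈ varIdeal k n i) : p ∈ varIdeal k n i := by
  rw [varIdeal, mem_ideal_span_X_image] at *
  intro d hd
  obtain ⟨j, hj, hj'⟩ := h (Finsupp.single i 1 + d) (by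
    rw [mem_support_iff, coeff_X_mul]
    exact mem_support_iff.1 hd)
  refine ⟨j, hj, ?_⟩
  have hij : i ≠ j := by
    rintro rfl
    exact lt_irrefl i.val (show i.val < i.val from hj)
  simpa [Finsupp.single_apply, hij] using hj'

theorem varIdeal_succ (k : Type) [Field k] (n : ℕ) (i : Fin n) :
    varIdeal k n (i+1) = Ideal.span {X i} ⊔ varIdeal k n i := by
  rw [varIdeal, varIdeal, ← Ideal.span_union, ← Set.image_singleton, ← Set.image_union]
  congr 2
  ext j
  simp only [Set.mem_ofPred_eq, Set.mem_union, Set.mem_singleton_iff, Fin.ext_iff]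
  omega

theorem selfDual_varIdeal (k : Type) [Field k] (n : ℕ) (i : ℕ) (hi : i ≤ n) :
    SelfDualExt (MvPolynomial (Fin n) k) (MvPolynomial (Fin n) k ⧸ varIdeal k n i) i := by
  induction i with
  | zero =>
    have : varIdeal k n 0 = ⊥ := by simp [varIdeal]
    exact selfDual_congr (Submodule.quotEquivOfEqBot _ this).symm (selfDual_base _)
  | succ i ih =>
    have ih := ih (by omega)
    let i' : Fin n := ⟨i, by omega⟩
    have hs : varIdeal k n (i+1) = Ideal.span {X i'} ⊔ varIdeal k n i := varIdeal_succ k n i'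
    have hle : varIdeal k n i ≤ varIdeal k n (i+1) := hs ▸ le_sup_right
    refine selfDual_step (X i') (Submodule.factor hle) ?_ (Submodule.factor_surjective hle) ?_ ih
    · intro v
      obtain ⟨p, rfl⟩ := Submodule.Quotient.mk_surjective _ v
      rw [← Submodule.Quotient.mk_smul, Submodule.Quotient.mk_eq_zero,
        Submodule.Quotient.mk_eq_zero, smul_eq_mul]
      exact mem_varIdeal_of_mul k n i' p
    · intro v
      obtain ⟨p, rfl⟩ := Submodule.Quotient.mk_surjective _ v
      have : Submodule.factor hle (Submodule.Quotient.mk p) = Submodule.Quotient.mk p := rfl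
      rw [this, Submodule.Quotient.mk_eq_zero, hs]
      constructor
      · intro h
        obtain ⟨a, ha, b, hb, rfl⟩ := Submodule.mem_sup.1 h
        obtain ⟨c, rfl⟩ := Ideal.mem_span_singleton.1 ha
        refine ⟨Submodule.Quotient.mk c, ?_⟩
        rw [← Submodule.Quotient.mk_smul, Submodule.Quotient.eq, smul_eq_mul]
        simpa using hb
      · rintro ⟨w, hw⟩
        obtain ⟨c, rfl⟩ := Submodule.Quotient.mk_surjective _ w
        rw [← Submodule.Quotient.mk_smul, Submodule.Quotient.eq, smul_eq_mul] at hw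
        have : p = X i' * c - (X i' * c - p) := by ring
        rw [this]
        exact sub_mem (Ideal.mem_sup_left (Ideal.mem_span_singleton.2 ⟨c, rfl⟩))
          (Ideal.mem_sup_right hw)

/-- Restriction of scalars along `k → R`. -/
abbrev kMod (k R M : Type) [Field k] [CommRing R] [Algebra k R] [AddCommGroup M] [Module R M] :
    Module k M := Module.compHom M (algebraMap k R)

/-- Restriction of scalars is compatible with the scalar tower. -/
theorem kMod_tower (k R M : Type) [Field k] [CommRing R] [Algebra k R] [AddCommGroup M]
    [Module R M] : let _ := kMod k R M; IsScalarTower k R M := by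
  let _ := kMod k R M
  refine ⟨fun a r v => ?_⟩
  change (a • r) • v = algebraMap k R a • r • v
  rw [Algebra.smul_def, mul_smul]

/-- `k`-length of a module over a `k`-algebra. -/
noncomputable def klen (k R M : Type) [Field k] [CommRing R] [Algebra k R] [AddCommGroup M]
    [Module R M] : ℕ∞ :=
  let _ := kMod k R M
  Module.length k M

section klen
variable {k R : Type} [Field k] [CommRing R] [Algebra k R]

theorem klen_eq_length {M V : Type} [AddCommGroup M] [Module R M] [AddCommGroup V] [Module k V]
    (e : M ≃+ V) (he : ∀ (c : k) (v : M), e (algebraMap k R c • v) = c • e v) :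
    klen k R M = Module.length k V := by
  let _ := kMod k R M
  exact LinearEquiv.length_eq
    ({ e with map_smul' := fun c v => he c v } : M ≃ₗ[k] V)

theorem klen_congr {M N : Type} [AddCommGroup M] [Module R M] [AddCommGroup N] [Module R N]
    (e : M ≃ₗ[R] N) : klen k R M = klen k R N := by
  let _ := kMod k R M
  let _ := kMod k R N
  have := kMod_tower k R M
  have := kMod_tower k R N
  exact (e.restrictScalars k).length_eq

theorem klen_exact {M N P : Type} [AddCommGroup M] [Module R M] [AddCommGroup N] [Module R N]
    [AddCommGroup P] [Module R P] (f : M →ₗ[R] N) (g : N →ₗ[R] P) (hf : Function.Injective f)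
    (hg : Function.Surjective g) (hfg : Function.Exact f g) :
    klen k R N = klen k R M + klen k R P := by
  let _ := kMod k R M
  let _ := kMod k R N
  let _ := kMod k R P
  have := kMod_tower k R M
  have := kMod_tower k R N
  have := kMod_tower k R P
  exact Module.length_eq_add_of_exact (f.restrictScalars k) (g.restrictScalars k) hf hg hfg

theorem klen_eq_zero {M : Type} [AddCommGroup M] [Module R M] :
    klen k R M = 0 ↔ Subsingleton M := by
  let _ := kMod k R M
  exact Module.length_eq_zero_iff

/-- compare with a finite-dimensional vector space. -/
theorem klen_dual {M V : Type} [AddCommGroup M] [Module R M] [AddCommGroup V] [Module k V]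
    [Module.Finite k V] (h : klen k R M = Module.length k V) :
    Nonempty (RestrictScalars k R M ≃ₗ[k] Module.Dual k V) := by
  let _ := kMod k R M
  have h1 : (Module.rank k M).toENat = Module.finrank k V := by
    rw [← Module.length_eq_rank, ← Module.length_eq_finrank]
    exact h
  have h2 : Module.rank k M = Module.finrank k V := by
    simpa using h1
  have : Module.Finite k M := by
    rw [← Module.rank_lt_aleph0_iff, h2]
    exact Cardinal.natCast_lt_aleph0
  have h3 : Module.finrank k M = Module.finrank k (Module.Dual k V) := by
    rw [Subspace.dual_finrank_eq]
    exact Module.finrank_eq_of_rank_eq h2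
  have e : M ≃ₗ[k] Module.Dual k V := LinearEquiv.ofFinrankEq _ _ h3
  exact ⟨e⟩

end klen

theorem ee_finite_length (k : Type) [Field k] (n : ℕ) (N : Type) [AddCommGroup N]
    [Module (MvPolynomial (Fin n) k) N] (hfin : Module.Finite (MvPolynomial (Fin n) k) N)
    (b : ℕ) (hb : ∀ (i : Fin n) (v : N), (X i : MvPolynomial (Fin n) k) ^ b • v = 0) :
    (∀ j, j ≠ n → Subsingleton (EE (MvPolynomial (Fin n) k) N j)) ∧
      klen k (MvPolynomial (Fin n) k) (EE (MvPolynomial (Fin n) k) N n) =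
        klen k (MvPolynomial (Fin n) k) N := by
  revert hb
  induction hfin using
    IsNoetherianRing.induction_on_isQuotientEquivQuotientPrime (MvPolynomial (Fin n) k) with
  | subsingleton N =>
    intro _
    have key : ∀ j, Subsingleton (EE (MvPolynomial (Fin n) k) N j) := by
      intro j
      refine subsingleton_of_forall_eq 0 fun a => ?_
      have h1 : 𝟙 (ModuleCat.of (MvPolynomial (Fin n) k) N) = 0 := by
        ext x
        exact Subsingleton.elim (α := N) _ _
      rw [← Abelian.Ext.mk₀_id_comp a, h1, Abelian.Ext.mk₀_zero, Abelian.Ext.zero_comp]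
    exact ⟨fun j _ => key j, by rw [klen_eq_zero.2 (key n), klen_eq_zero.2 inferInstance]⟩
  | quotient N p e =>
    intro hb
    have hmem : ∀ i, X i ∈ p.1 := by
      intro i
      apply p.2.mem_of_pow_mem b
      have := hb i (e.symm (Submodule.Quotient.mk 1))
      rw [← map_smul, map_eq_zero_iff _ e.symm.injective, ← Submodule.Quotient.mk_smul,
        Submodule.Quotient.mk_eq_zero] at this
      simpa using this
    have hp : p.1 = varIdeal k n n := by
      have hle : varIdeal k n n ≤ p.1 := by
        rw [varIdeal, Ideal.span_le]
        rintro _ ⟨i, -, rfl⟩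
        exact hmem i
      refine le_antisymm (fun q hq => ?_) hle
      have h1 : q - C (constantCoeff q) ∈ varIdeal k n n := by
        rw [varIdeal, mem_ideal_span_X_image]
        intro d hd
        by_contra hcon
        push Not at hcon
        have hd0 : d = 0 := by
          ext i
          exact hcon i i.2
        subst hd0
        rw [mem_support_iff] at hd
        apply hd
        simp [constantCoeff_eq]
      have h2 : (C (constantCoeff q) : MvPolynomial (Fin n) k) ∈ p.1 := by
        have := sub_mem hq (hle h1)
        simpa using this
      by_cases h3 : constantCoeff q = 0
      · simpa [h3] using h1
      · exfalso
        apply p.2.ne_top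
        exact Ideal.eq_top_of_isUnit_mem _ h2 ((isUnit_iff_ne_zero.2 h3).map C)
    have h := selfDual_congr ((Submodule.quotEquivOfEq _ _ hp).symm.trans e.symm)
      (selfDual_varIdeal k n n le_rfl)
    obtain ⟨e'⟩ := h.2
    exact ⟨h.1, klen_congr e'⟩
  | exact N₁ N₂ N₃ f g hf hg hfg h₁ h₃ =>
    intro hb
    have h₁ := h₁ fun i v => hf (by rw [map_smul, hb, map_zero])
    have h₃ := h₃ fun i v => by
      obtain ⟨v, rfl⟩ := hg v
      rw [← map_smul, hb, map_zero]
    refine ⟨fun j hj => ee_mid f g hf hg hfg j (h₁.1 j hj) (h₃.1 j hj), ?_⟩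
    obtain ⟨fs, gs, δ, -, k1, k2, k3, k4⟩ := ee_les f g hf hg hfg
    have hsur : Function.Surjective (fs n) := by
      intro a
      have := h₃.1 (n+1) (by omega)
      exact (k2 n a).1 (Subsingleton.elim _ _)
    have hinj : Function.Injective (gs n) := by
      rcases n with _ | n
      · exact k4
      · rw [injective_iff_map_eq_zero]
        intro a ha
        obtain ⟨c, rfl⟩ := (k3 n a).1 ha
        have := h₁.1 n (by omega)
        rw [Subsingleton.elim c 0, map_zero]
    rw [klen_exact f g hf hg hfg, klen_exact (gs n) (fs n) hinj hsur (k1 n), h₁.2, h₃.2, add_comm]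

section poly
variable {k : Type} [Field k] {n : ℕ}

theorem mem_pow_iff_component (a : ℕ) (g : MvPolynomial (Fin n) k) :
    g ∈ (Ideal.span (Set.range (X : Fin n → MvPolynomial (Fin n) k))) ^ a ↔
      ∀ e < a, homogeneousComponent e g = 0 := by
  have h0 := MvPolynomial.mem_pow_idealOfVars_iff' (σ := Fin n) (R := k) a g
  refine h0.trans ⟨fun h e he => ?_, fun h u hu => ?_⟩
  · ext u
    rw [coeff_homogeneousComponent, coeff_zero]
    split_ifs with hu
    · exact h u (hu ▸ he)
    · rfl
  · have := congrArg (coeff u) (h _ hu)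
    rwa [coeff_homogeneousComponent, if_pos rfl, coeff_zero] at this

theorem component_mul {φ : MvPolynomial (Fin n) k} {d : ℕ} (hφ : φ.IsHomogeneous d) (e : ℕ)
    (h : MvPolynomial (Fin n) k) :
    homogeneousComponent (e + d) (φ * h) = φ * homogeneousComponent e h := by
  induction h using MvPolynomial.induction_on' with
  | monomial u c =>
    have h1 : (monomial u c).IsHomogeneous u.degree := isHomogeneous_monomial c rfl
    have h2 := hφ.mul h1
    rw [homogeneousComponent_of_mem h2, homogeneousComponent_of_mem h1]
    by_cases he : e = u.degree
    · rw [if_pos he, if_pos (by omega)]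
    · rw [if_neg he, if_neg (by omega), mul_zero]
  | add p q hp hq => rw [mul_add, map_add, map_add, hp, hq, mul_add]

theorem quadric_homog : (quadricSum k n).IsHomogeneous 2 :=
  IsHomogeneous.sum _ _ _ fun i _ => by simpa using (isHomogeneous_X k i).pow 2

theorem quadric_ne_zero (hn : 0 < n) : quadricSum k n ≠ 0 := by
  intro h
  have h1 := congrArg (MvPolynomial.eval (fun i : Fin n => if i = ⟨0, hn⟩ then (1:k) else 0)) h
  simp [quadricSum] at h1

theorem mem_degGE_pow {s : ℤ} {a : ℕ} {g : MvPolynomial (Fin n) k} (hg : g ∈ degGE k n s)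
    (hs : s.toNat = a) :
    g ∈ (Ideal.span (Set.range (X : Fin n → MvPolynomial (Fin n) k))) ^ a := by
  rw [degGE, hs] at hg
  exact hg

/-- Truncation in degrees `≤ d`. -/
def lowPart (d : ℕ) (g : MvPolynomial (Fin n) k) : MvPolynomial (Fin n) k :=
  ∑ e ∈ Finset.range (d + 1), homogeneousComponent e g

theorem coeff_lowPart (d : ℕ) (g : MvPolynomial (Fin n) k) (u : Fin n →₀ ℕ) :
    coeff u (lowPart d g) = if u.degree ≤ d then coeff u g else 0 := by
  simp only [lowPart, coeff_sum, coeff_homogeneousComponent]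
  rw [Finset.sum_ite_eq]
  simp

theorem lowPart_mem (d : ℕ) (g : MvPolynomial (Fin n) k) :
    lowPart d g ∈ restrictTotalDegree (Fin n) k d := by
  rw [mem_restrictTotalDegree]
  refine Finset.sup_le fun u hu => ?_
  rw [mem_support_iff, coeff_lowPart] at hu
  by_contra hcon
  apply hu
  rw [if_neg]
  exact hcon

theorem lowPart_eq (d : ℕ) (g : MvPolynomial (Fin n) k)
    (hg : g ∈ restrictTotalDegree (Fin n) k d) : lowPart d g = g := by
  rw [mem_restrictTotalDegree] at hg
  ext u
  rw [coeff_lowPart]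
  split_ifs with hu
  · rfl
  · by_contra hcon
    apply hu
    exact (le_totalDegree (mem_support_iff.2 (Ne.symm hcon))).trans hg

theorem sub_lowPart_mem (d : ℕ) (g : MvPolynomial (Fin n) k) :
    g - lowPart d g ∈ (Ideal.span (Set.range (X : Fin n → MvPolynomial (Fin n) k))) ^ (d + 1) := by
  refine (MvPolynomial.mem_pow_idealOfVars_iff' (σ := Fin n) (R := k) _ _).2 fun u hu => ?_
  rw [coeff_sub, coeff_lowPart, if_pos (by omega), sub_self]

theorem lowPart_eq_zero (d : ℕ) (g : MvPolynomial (Fin n) k)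
    (hg : g ∈ (Ideal.span (Set.range (X : Fin n → MvPolynomial (Fin n) k))) ^ (d + 1)) :
    lowPart d g = 0 := by
  rw [mem_pow_iff_component] at hg
  exact Finset.sum_eq_zero fun e he => hg e (Finset.mem_range.1 he)

theorem lowPart_mul_mem (d : ℕ) (h : MvPolynomial (Fin n) k) :
    lowPart d (quadricSum k n * h) ∈ Ideal.span {quadricSum k n} := by
  refine Ideal.sum_mem _ fun e _ => ?_
  rcases Nat.lt_or_ge e 2 with he | he
  · have : quadricSum k n * h ∈
        (Ideal.span (Set.range (X : Fin n → MvPolynomial (Fin n) k))) ^ 2 :=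
      Ideal.mul_mem_right _ _ (quadricSum_mem_sq k n)
    rw [(mem_pow_iff_component _ _).1 this e he]
    exact zero_mem _
  · obtain ⟨e, rfl⟩ := Nat.exists_eq_add_of_le' he
    rw [component_mul quadric_homog]
    exact Ideal.mul_mem_right _ _ (Ideal.mem_span_singleton_self _)

theorem lowPart_sub (d : ℕ) (g h : MvPolynomial (Fin n) k) :
    lowPart d (g - h) = lowPart d g - lowPart d h := by
  simp [lowPart, Finset.sum_sub_distrib]

end poly

theorem klen_of_bij {k R : Type} [Field k] [CommRing R] [Algebra k R] {M V : Type}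
    [AddCommGroup M] [Module R M] [AddCommGroup V] [Module k V]
    (e : V →+ M) (hi : Function.Injective e) (hs : Function.Surjective e)
    (he : ∀ (c : k) (v : V), e (c • v) = algebraMap k R c • e v) :
    klen k R M = Module.length k V := by
  let e' := AddEquiv.ofBijective e ⟨hi, hs⟩
  refine klen_eq_length e'.symm fun c v => ?_
  rw [AddEquiv.symm_apply_eq]
  change _ = e _
  rw [he]
  congr 1
  exact (e'.apply_symm_apply v).symm

section modules
variable (k : Type) [Field k] (n : ℕ) (q s : ℤ) (h : s.toNat ≤ q.toNat + 2)

/-- The cokernel. -/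
abbrev GG : Type := ↥(degGE k n s) ⧸ LinearMap.range (quadricMulMap k n q s h)

/-- The coordinate ring of the quadric cone. -/
abbrev QQ : Type := MvPolynomial (Fin n) k ⧸ Ideal.span {quadricSum k n}

/-- The natural map from the cokernel to the coordinate ring. -/
def psi : GG k n q s h →ₗ[MvPolynomial (Fin n) k] QQ k n :=
  Submodule.liftQ _ ((Submodule.mkQ (Ideal.span {quadricSum k n})).comp
    (Submodule.subtype (degGE k n s))) (by
      rintro _ ⟨v, rfl⟩
      rw [LinearMap.mem_ker]
      change Submodule.Quotient.mk (quadricSum k n * v.1) = _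
      rw [Submodule.Quotient.mk_eq_zero]
      exact Ideal.mul_mem_right _ _ (Ideal.mem_span_singleton_self _))

theorem psi_mk (v : degGE k n s) :
    psi k n q s h (Submodule.Quotient.mk v) = Submodule.Quotient.mk v.1 := rfl

theorem psi_mk_eq_zero (v : degGE k n s) :
    psi k n q s h (Submodule.Quotient.mk v) = 0 ↔ ∃ g, v.1 = quadricSum k n * g := by
  rw [psi_mk, Submodule.Quotient.mk_eq_zero, Ideal.mem_span_singleton]
  rfl

theorem GG_mk_eq_zero (v : degGE k n s) :
    (Submodule.Quotient.mk v : GG k n q s h) = 0 ↔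
      ∃ g ∈ degGE k n q, v.1 = quadricSum k n * g := by
  rw [Submodule.Quotient.mk_eq_zero]
  constructor
  · rintro ⟨g, rfl⟩
    exact ⟨g.1, g.2, rfl⟩
  · rintro ⟨g, hg, hv⟩
    exact ⟨⟨g, hg⟩, Subtype.ext hv.symm⟩

theorem X_pow_mem (i : Fin n) :
    (X i : MvPolynomial (Fin n) k) ^ q.toNat ∈ degGE k n q :=
  Ideal.pow_mem_pow (Ideal.subset_span (Set.mem_range_self i)) _

theorem ker_killed (i : Fin n) (v : LinearMap.ker (psi k n q s h)) :
    (X i : MvPolynomial (Fin n) k) ^ q.toNat • v = 0 := by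
  obtain ⟨v, hv⟩ := v
  obtain ⟨v, rfl⟩ := Submodule.Quotient.mk_surjective _ v
  rw [LinearMap.mem_ker, psi_mk_eq_zero] at hv
  obtain ⟨g, hg⟩ := hv
  apply Subtype.ext
  change (X i : MvPolynomial (Fin n) k) ^ q.toNat • (Submodule.Quotient.mk v : GG k n q s h) = 0
  rw [← Submodule.Quotient.mk_smul, GG_mk_eq_zero]
  refine ⟨X i ^ q.toNat * g, Ideal.mul_mem_right _ _ (X_pow_mem k n q i), ?_⟩
  change X i ^ q.toNat * v.1 = _
  rw [hg]
  ring

theorem coker_killed (i : Fin n) (v : QQ k n ⧸ LinearMap.range (psi k n q s h)) :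
    (X i : MvPolynomial (Fin n) k) ^ s.toNat • v = 0 := by
  obtain ⟨v, rfl⟩ := Submodule.Quotient.mk_surjective _ v
  obtain ⟨v, rfl⟩ := Submodule.Quotient.mk_surjective _ v
  rw [← Submodule.Quotient.mk_smul, Submodule.Quotient.mk_eq_zero]
  exact ⟨Submodule.Quotient.mk ⟨X i ^ s.toNat * v,
    Ideal.mul_mem_right _ _ (X_pow_mem k n s i)⟩, rfl⟩

theorem klen_coker (d : ℕ) (hd : s.toNat = d + 1) :
    klen k (MvPolynomial (Fin n) k) (QQ k n ⧸ LinearMap.range (psi k n q s h)) =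
      Module.length k (imageLowDegree k n d) := by
  refine klen_of_bij
    (((Submodule.mkQ (LinearMap.range (psi k n q s h))).toAddMonoidHom).comp
      (imageLowDegree k n d).subtype.toAddMonoidHom) ?_ ?_ ?_
  · rw [injective_iff_map_eq_zero]
    rintro ⟨_, g, hg, rfl⟩ h0
    have h1 : (Submodule.Quotient.mk g : QQ k n) ∈ LinearMap.range (psi k n q s h) :=
      (Submodule.Quotient.mk_eq_zero _).1 h0
    obtain ⟨w, hw⟩ := h1
    obtain ⟨w, rfl⟩ := Submodule.Quotient.mk_surjective _ w
    rw [psi_mk, eq_comm, Submodule.Quotient.eq, Ideal.mem_span_singleton] at hw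
    obtain ⟨c, hc⟩ := hw
    apply Subtype.ext
    change (Submodule.Quotient.mk g : QQ k n) = 0
    rw [Submodule.Quotient.mk_eq_zero]
    have h2 := congrArg (lowPart d) hc
    have hw' := mem_degGE_pow w.2 hd
    rw [lowPart_sub, lowPart_eq d g hg, lowPart_eq_zero d _ hw', sub_zero] at h2
    rw [h2]
    exact lowPart_mul_mem d c
  · intro v
    obtain ⟨v, rfl⟩ := Submodule.Quotient.mk_surjective _ v
    obtain ⟨v, rfl⟩ := Submodule.Quotient.mk_surjective _ v
    refine ⟨⟨_, lowPart d v, lowPart_mem d v, rfl⟩, ?_⟩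
    change (Submodule.Quotient.mk (Submodule.Quotient.mk (lowPart d v) : QQ k n) :
      QQ k n ⧸ LinearMap.range (psi k n q s h)) = _
    rw [eq_comm, Submodule.Quotient.eq]
    refine ⟨Submodule.Quotient.mk ⟨v - lowPart d v, ?_⟩, rfl⟩
    rw [degGE, hd]
    exact sub_lowPart_mem d v
  · rintro c ⟨_, g, hg, rfl⟩
    change (Submodule.Quotient.mk (Submodule.Quotient.mk (c • g) : QQ k n) :
      QQ k n ⧸ LinearMap.range (psi k n q s h)) = algebraMap k _ c • (Submodule.Quotient.mk (Submodule.Quotient.mk g : QQ k n) :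
      QQ k n ⧸ LinearMap.range (psi k n q s h))
    rw [← Submodule.Quotient.mk_smul, ← Submodule.Quotient.mk_smul, smul_eq_mul, Algebra.smul_def]

theorem coker_subsingleton (hs : s.toNat = 0) :
    Subsingleton (QQ k n ⧸ LinearMap.range (psi k n q s h)) := by
  refine subsingleton_of_forall_eq 0 fun v => ?_
  obtain ⟨v, rfl⟩ := Submodule.Quotient.mk_surjective _ v
  obtain ⟨v, rfl⟩ := Submodule.Quotient.mk_surjective _ v
  rw [Submodule.Quotient.mk_eq_zero]
  exact ⟨Submodule.Quotient.mk ⟨v, by rw [degGE, hs, pow_zero, Ideal.one_eq_top]; trivial⟩, rfl⟩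

theorem ker_subsingleton (hq : q.toNat = 0) : Subsingleton (LinearMap.ker (psi k n q s h)) := by
  refine subsingleton_of_forall_eq 0 fun v => ?_
  obtain ⟨v, hv⟩ := v
  obtain ⟨v, rfl⟩ := Submodule.Quotient.mk_surjective _ v
  rw [LinearMap.mem_ker, psi_mk_eq_zero] at hv
  obtain ⟨g, hg⟩ := hv
  apply Subtype.ext
  change (Submodule.Quotient.mk v : GG k n q s h) = 0
  rw [GG_mk_eq_zero]
  exact ⟨g, by rw [degGE, hq, pow_zero, Ideal.one_eq_top]; trivial, hg⟩

/-- The class of `f * g`, for `g` homogeneous. -/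
def kerMap (d : ℕ) (hs : s.toNat = d + 2) :
    homogeneousSubmodule (Fin n) k d →+ LinearMap.ker (psi k n q s h) :=
  AddMonoidHom.mk' (fun g => ⟨Submodule.Quotient.mk ⟨quadricSum k n * g.1, by
      rw [degGE, hs, mem_pow_iff_component]
      intro e he
      rw [homogeneousComponent_of_mem (quadric_homog.mul g.2), if_neg (by omega)]⟩, by
        rw [LinearMap.mem_ker, psi_mk_eq_zero]
        exact ⟨_, rfl⟩⟩) (by
    intro a b
    apply Subtype.ext
    apply congrArg Submodule.Quotient.mk
    apply Subtype.ext
    exact mul_add _ _ _)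

theorem klen_ker (hn : 0 < n) (d : ℕ) (hs : s.toNat = d + 2) (hq : q.toNat = d + 1) :
    klen k (MvPolynomial (Fin n) k) (LinearMap.ker (psi k n q s h)) =
      Module.length k (homogeneousSubmodule (Fin n) k d) := by
  have hf := quadric_ne_zero (k := k) hn
  refine klen_of_bij (kerMap k n q s h d hs) ?_ ?_ ?_
  · rw [injective_iff_map_eq_zero]
    rintro ⟨g, hg⟩ h0
    have h1 := congrArg Subtype.val h0
    obtain ⟨c, hc, hgc⟩ := (GG_mk_eq_zero k n q s h _).1 h1
    have hgc : g = c := mul_left_cancel₀ hf hgc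
    subst hgc
    rw [degGE, hq, mem_pow_iff_component] at hc
    have := hc d (by omega)
    rw [homogeneousComponent_of_mem hg, if_pos rfl] at this
    exact Subtype.ext this
  · rintro ⟨v, hv⟩
    obtain ⟨v, rfl⟩ := Submodule.Quotient.mk_surjective _ v
    rw [LinearMap.mem_ker, psi_mk_eq_zero] at hv
    obtain ⟨g, hg⟩ := hv
    have hv2 := (mem_pow_iff_component _ _).1 (mem_degGE_pow v.2 hs)
    have hlow : ∀ e < d, homogeneousComponent e g = 0 := by
      intro e he
      have := hv2 (e + 2) (by omega)
      rw [hg, component_mul quadric_homog] at this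
      exact (mul_eq_zero.1 this).resolve_left hf
    refine ⟨⟨homogeneousComponent d g, homogeneousComponent_mem d g⟩, ?_⟩
    apply Subtype.ext
    refine (sub_eq_zero.1 ?_).symm
    change (Submodule.Quotient.mk v : GG k n q s h) - Submodule.Quotient.mk _ = 0
    rw [← Submodule.Quotient.mk_sub, GG_mk_eq_zero]
    refine ⟨g - homogeneousComponent d g, ?_, ?_⟩
    · rw [degGE, hq, mem_pow_iff_component]
      intro e he
      rw [map_sub, homogeneousComponent_of_mem (homogeneousComponent_mem d g)]
      split_ifs with hed
      · rw [hed, sub_self]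
      · rw [hlow e (by omega), sub_zero]
    · change v.1 - quadricSum k n * homogeneousComponent d g = _
      rw [hg, mul_sub]
  · rintro c ⟨g, hg⟩
    apply Subtype.ext
    change (Submodule.Quotient.mk _ : GG k n q s h) =
      algebraMap k (MvPolynomial (Fin n) k) c • Submodule.Quotient.mk _
    rw [← Submodule.Quotient.mk_smul]
    apply congrArg Submodule.Quotient.mk
    apply Subtype.ext
    change quadricSum k n * (c • g) = algebraMap k _ c * (quadricSum k n * g)
    rw [Algebra.smul_def]
    ring

theorem selfDual_QQ (hn : 0 < n) : SelfDualExt (MvPolynomial (Fin n) k) (QQ k n) 1 := by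
  refine selfDual_step (quadricSum k n) (Submodule.mkQ (Ideal.span {quadricSum k n})) ?_
    (Submodule.mkQ_surjective _) ?_ (selfDual_base _)
  · intro v hv
    exact (mul_eq_zero.1 hv).resolve_left (quadric_ne_zero hn)
  · intro v
    rw [Submodule.mkQ_apply, Submodule.Quotient.mk_eq_zero, Ideal.mem_span_singleton]
    exact ⟨fun ⟨c, hc⟩ => ⟨c, hc.symm⟩, fun ⟨c, hc⟩ => ⟨c, hc.symm⟩⟩

theorem ee_GG (m : ℕ) (hm : n = m + 4) :
    (∀ j, j ≠ 1 → j ≠ m + 3 → j ≠ m + 4 →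
      Subsingleton (EE (MvPolynomial (Fin n) k) (GG k n q s h) j)) ∧
    Nonempty (EE (MvPolynomial (Fin n) k) (GG k n q s h) 1 ≃ₗ[MvPolynomial (Fin n) k] QQ k n) ∧
    (klen k (MvPolynomial (Fin n) k) (EE (MvPolynomial (Fin n) k) (GG k n q s h) (m + 3)) =
      klen k (MvPolynomial (Fin n) k) (QQ k n ⧸ LinearMap.range (psi k n q s h))) ∧
    (klen k (MvPolynomial (Fin n) k) (EE (MvPolynomial (Fin n) k) (GG k n q s h) (m + 4)) =
      klen k (MvPolynomial (Fin n) k) (LinearMap.ker (psi k n q s h))) := by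
  subst hm
  have hQ := selfDual_QQ k (m + 4) (by omega)
  have hT := ee_finite_length k (m + 4) (LinearMap.ker (psi k (m + 4) q s h)) inferInstance q.toNat
    (ker_killed k (m + 4) q s h)
  have hS := ee_finite_length k (m + 4) (QQ k (m + 4) ⧸ LinearMap.range (psi k (m + 4) q s h)) inferInstance s.toNat
    (coker_killed k (m + 4) q s h)
  -- first sequence
  have a1 := Submodule.injective_subtype (LinearMap.range (psi k (m + 4) q s h))
  have a2 := Submodule.mkQ_surjective (LinearMap.range (psi k (m + 4) q s h))
  have a3 := LinearMap.exact_subtype_mkQ (LinearMap.range (psi k (m + 4) q s h))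
  -- second sequence
  have b1 := Submodule.injective_subtype (LinearMap.ker (psi k (m + 4) q s h))
  have b2 := LinearMap.surjective_rangeRestrict (psi k (m + 4) q s h)
  have b3 : Function.Exact (LinearMap.ker (psi k (m + 4) q s h)).subtype
      (psi k (m + 4) q s h).rangeRestrict := by
    rw [LinearMap.exact_iff]
    simp
  have hH : ∀ j, j ≠ 1 → j ≠ m + 3 → Subsingleton
      (EE (MvPolynomial (Fin (m + 4)) k) (LinearMap.range (psi k (m + 4) q s h)) j) := fun j h1 h2 =>
    ee_left _ _ a1 a2 a3 j (hQ.1 j h1) (hS.1 _ (by omega))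
  obtain ⟨e1⟩ := ee_equiv_mid_left _ _ a1 a2 a3 1 (hS.1 _ (by omega)) (hS.1 _ (by omega))
  obtain ⟨e2⟩ := ee_equiv_left_right _ _ a1 a2 a3 (m + 3) (hQ.1 _ (by omega)) (hQ.1 _ (by omega))
  obtain ⟨e3⟩ := ee_equiv_right_mid _ _ b1 b2 b3 0 (hT.1 _ (by omega)) (hT.1 _ (by omega))
  obtain ⟨e4⟩ := ee_equiv_right_mid _ _ b1 b2 b3 (m + 2) (hT.1 _ (by omega)) (hT.1 _ (by omega))
  obtain ⟨e5⟩ := ee_equiv_mid_left _ _ b1 b2 b3 (m + 4) (hH _ (by omega) (by omega))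
    (hH _ (by omega) (by omega))
  obtain ⟨e6⟩ := hQ.2
  refine ⟨fun j h1 h2 h3 => ee_mid _ _ b1 b2 b3 j (hT.1 j (by omega)) (hH j h1 h2), ?_, ?_, ?_⟩
  · exact ⟨e3.symm.trans (e1.symm.trans e6)⟩
  · exact (klen_congr (e4.symm.trans e2)).trans hS.2
  · exact (klen_congr e5).trans hT.2

end modules

/-- (Example 4.3 of the paper, odd case `n = 2m+1`.)  For
`R = k[x₁,…,xₙ]`, `f = x₁²+⋯+xₙ²` and `G_p = coker(f : R^{≥p−m} → R^{≥p−m+1})`: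
(i) `Ext^j_R(G_p, R) = 0` for `j ∉ {1, n−1, n}`;
(ii) `Ext^1_R(G_p, R) ≅ R/(f)`;
(iii) `Ext^{n−1}_R(G_p, R)` is `k`-dual to the image in `R/(f)` of the polynomials of
degree `≤ p−m` (zero when `p < m`);
(iv) `Ext^n_R(G_p, R)` is `k`-dual to the homogeneous polynomials of degree `p−m−1`
(zero when `p ≤ m`). -/
theorem quadric_cone_ext_computation_odd (k : Type) [Field k] [CharZero k]
    (m : ℕ) (hm : 2 ≤ m) (p : ℕ) :
    (∀ j : ℕ, j ∉ ({1, 2 * m, 2 * m + 1} : Set ℕ) → Subsingleton ↥(quadricExtOdd k m p j)) ∧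
    Nonempty
      (quadricExtOdd k m p 1 ≅
        ModuleCat.of (MvPolynomial (Fin (2 * m + 1)) k)
          (MvPolynomial (Fin (2 * m + 1)) k ⧸ Ideal.span {quadricSum k (2 * m + 1)})) ∧
    ((m ≤ p →
        Nonempty
          ((RestrictScalars k (MvPolynomial (Fin (2 * m + 1)) k)
              ↥(quadricExtOdd k m p (2 * m))) ≃ₗ[k]
            Module.Dual k ↥(imageLowDegree k (2 * m + 1) (p - m)))) ∧
      (p < m → Subsingleton ↥(quadricExtOdd k m p (2 * m)))) ∧
    ((m + 1 ≤ p →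
        Nonempty
          ((RestrictScalars k (MvPolynomial (Fin (2 * m + 1)) k)
              ↥(quadricExtOdd k m p (2 * m + 1))) ≃ₗ[k]
            Module.Dual k
              ↥(homogeneousSubmodule (Fin (2 * m + 1)) k (p - m - 1)))) ∧
      (p ≤ m → Subsingleton ↥(quadricExtOdd k m p (2 * m + 1)))) := by
  obtain ⟨m, rfl⟩ := Nat.exists_eq_add_of_le' hm
  have hG := ee_GG k (2 * (m + 2) + 1) ((p : ℤ) - (m + 2 : ℕ)) ((p : ℤ) - (m + 2 : ℕ) + 1) (by omega)
    (2 * m + 1) (by ring)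
  have hE : ∀ j, Nonempty (↥(quadricExtOdd k (m + 2) p j)
      ≃ₗ[MvPolynomial (Fin (2 * (m + 2) + 1)) k]
      EE (MvPolynomial (Fin (2 * (m + 2) + 1)) k) (GG k (2 * (m + 2) + 1)
        ((p : ℤ) - (m + 2 : ℕ)) ((p : ℤ) - (m + 2 : ℕ) + 1) (by omega)) j) :=
    fun j => extCompare _ _ j
  obtain ⟨h0, ⟨h1⟩, h2, h3⟩ := hG
  rw [show 2 * m + 1 + 3 = 2 * (m + 2) by ring] at h2
  rw [show 2 * m + 1 + 4 = 2 * (m + 2) + 1 by ring] at h3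
  refine ⟨fun j hj => ?_, ?_, ⟨fun hp => ?_, fun hp => ?_⟩, ⟨fun hp => ?_, fun hp => ?_⟩⟩
  · simp only [Set.mem_insert_iff, Set.mem_singleton_iff, not_or] at hj
    obtain ⟨e⟩ := hE j
    have := h0 j hj.1 (by omega) (by omega)
    exact e.injective.subsingleton
  · obtain ⟨e⟩ := hE 1
    exact ⟨(e.trans h1).toModuleIso⟩
  · obtain ⟨e⟩ := hE (2 * (m + 2))
    have hfin : Module.Finite k ↥(imageLowDegree k (2 * (m + 2) + 1) (p - (m + 2))) :=
      inferInstanceAs (Module.Finite k (Submodule.map _ _))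
    exact klen_dual ((klen_congr e).trans (h2.trans (klen_coker k _ _ _ _ _ (by omega))))
  · obtain ⟨e⟩ := hE (2 * (m + 2))
    rw [← klen_eq_zero (k := k) (R := MvPolynomial (Fin (2 * (m + 2) + 1)) k), klen_congr e, h2,
      klen_eq_zero]
    exact coker_subsingleton k _ _ _ _ (by omega)
  · obtain ⟨e⟩ := hE (2 * (m + 2) + 1)
    have hfin : Module.Finite k
        ↥(homogeneousSubmodule (Fin (2 * (m + 2) + 1)) k (p - (m + 2) - 1)) :=
      Module.Finite.iff_fg.2 (homogeneousSubmodule_fg _ _ _)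
    exact klen_dual ((klen_congr e).trans
      (h3.trans (klen_ker k _ _ _ _ (by omega) _ (by omega) (by omega))))
  · obtain ⟨e⟩ := hE (2 * (m + 2) + 1)
    rw [← klen_eq_zero (k := k) (R := MvPolynomial (Fin (2 * (m + 2) + 1)) k), klen_congr e, h3,
      klen_eq_zero]
    exact ker_subsingleton k _ _ _ _ (by omega)
end
end
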